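/- Let n ≥ 2 and let f : B → ℝⁿ \ {0} be a K-quasiregular mapping in the Miniowitz class (Min) with constants C₀, α, satisfying the multiplicity condition (M) with exponent 0 ≤ a < n−1 and constant C₁; let f̃ denote its non-tangential limit function (existing σ-a.e.). Let L ⊂ ℝⁿ be an (n−1)-dimensional linear subspace (a hyperplane through the origin). Then for every 0 < p < n: ∫_{L∩B} |f(x)|^p dH^{n−1}(x) ≤ C ∫_{S^{n−1}} |f̃(ω)|^p dσ(ω), where H^{n−1} is the (n−1)-dimensional Hausdorff measure and C depends only on n, p, K, a, α, C₀, C₁. -/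

import Mathlib

open MeasureTheory Metric Set Filter
open scoped ENNReal NNReal Topology Classical

noncomputable section

abbrev Vec (n : ℕ) := EuclideanSpace ℝ (Fin n)

/-- The open unit ball in `ℝⁿ`. -/
def unitBall (n : ℕ) : Set (Vec n) := Metric.ball 0 1

/-- The unit sphere `S^{n-1}` in `ℝⁿ`. -/
def unitSphere (n : ℕ) : Set (Vec n) := Metric.sphere 0 1

/-- Surface measure on the unit sphere, modelled by `(n-1)`-dimensional
Hausdorff measure restricted to the sphere. -/
def sphMeasure (n : ℕ) : Measure (Vec n) := (μH[(n : ℝ) - 1]).restrict (unitSphere n)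

/-- `f` is `K`-quasiregular on the unit ball. -/
def IsQR (n : ℕ) (K : ℝ) (f : Vec n → Vec n) : Prop :=
  ContinuousOn f (unitBall n) ∧
  (∀ x ∈ unitBall n, DifferentiableAt ℝ f x) ∧
  (∀ᵐ x ∂(volume.restrict (unitBall n)),
    ‖fderiv ℝ f x‖ ^ n ≤ K * (fderiv ℝ f x).det)

/-- The conformal automorphism `T_x` of the unit ball (with `T_0 = id`). -/
def mobiusT (n : ℕ) (x : Vec n) (y : Vec n) : Vec n :=
  if x = 0 then y
  else (‖x‖ ^ 2 * ‖y - (‖x‖ ^ 2)⁻¹ • x‖ ^ 2)⁻¹ •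
    ((1 - ‖x‖ ^ 2) • (y - x) - ‖y - x‖ ^ 2 • x)

/-- The Miniowitz class (Min) with constants `C₀, α`. -/
def InMiniowitz (n : ℕ) (C₀ α : ℝ) (f : Vec n → Vec n) : Prop :=
  ∀ x ∈ unitBall n, ∀ y ∈ unitBall n,
    C₀⁻¹ * ((1 - ‖y‖) / (1 + ‖y‖)) ^ α ≤ ‖f (mobiusT n (-x) y)‖ / ‖f (mobiusT n (-x) 0)‖ ∧
    ‖f (mobiusT n (-x) y)‖ / ‖f (mobiusT n (-x) 0)‖ ≤ C₀ * ((1 + ‖y‖) / (1 - ‖y‖)) ^ α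

/-- The multiplicity condition (M) with exponent `a` and constant `C₁`. -/
def MultCond (n : ℕ) (a C₁ : ℝ) (f : Vec n → Vec n) : Prop :=
  ∀ x ∈ unitBall n, ∀ r : ℝ, 0 < r → r < 1 → ∀ y : Vec n,
    (({z ∈ Metric.ball (0 : Vec n) r | f (mobiusT n (-x) z) = y}).encard : ℝ≥0∞) ≤
      ENNReal.ofReal (C₁ / (1 - r) ^ a)

/-- The non-tangential region `Γ(ω)` with aperture parameter `κ`. -/
def ntRegion (n : ℕ) (κ : ℝ) (ω : Vec n) : Set (Vec n) :=
  {x ∈ unitBall n | ‖x - ω‖ < (1 + κ) * (1 - ‖x‖)}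

/-- The non-tangential maximal function `f*`. -/
def ntMax (n : ℕ) (κ : ℝ) (f : Vec n → Vec n) (ω : Vec n) : ℝ≥0∞ :=
  ⨆ x ∈ ntRegion n κ ω, ENNReal.ofReal ‖f x‖

/-- `f` has the non-tangential limit `L` at `ω`. -/
def HasNTLimit (n : ℕ) (κ : ℝ) (f : Vec n → Vec n) (ω L : Vec n) : Prop :=
  Filter.Tendsto f (𝓝[ntRegion n κ ω] ω) (𝓝 L)

/-- The `p`-th mean of `f` on the sphere of radius `r`. -/
def hardyMean (n : ℕ) (p : ℝ) (f : Vec n → Vec n) (r : ℝ) : ℝ≥0∞ :=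
  (sphMeasure n (unitSphere n))⁻¹ *
    ∫⁻ ω, ENNReal.ofReal (‖f (r • ω)‖ ^ p) ∂(sphMeasure n)

/-- The Hardy `H^p` norm of `f` on the unit ball. -/
def hardyNorm (n : ℕ) (p : ℝ) (f : Vec n → Vec n) : ℝ≥0∞ :=
  (⨆ r ∈ Set.Ioo (0 : ℝ) 1, hardyMean n p f r) ^ (1 / p)

/-- `f` belongs to the Hardy space `H^p`. -/
def MemHp (n : ℕ) (p : ℝ) (f : Vec n → Vec n) : Prop := hardyNorm n p f < ⊤

/-- The `L^p(σ)` norm of a boundary function on the unit sphere. -/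
def lpSphere (n : ℕ) (p : ℝ) (g : Vec n → Vec n) : ℝ≥0∞ :=
  (∫⁻ ω, ENNReal.ofReal (‖g ω‖ ^ p) ∂(sphMeasure n)) ^ (1 / p)

/-- The `L^p(σ)` norm of the non-tangential maximal function `f*`. -/
def ntMaxLp (n : ℕ) (κ p : ℝ) (f : Vec n → Vec n) : ℝ≥0∞ :=
  (∫⁻ ω, (ntMax n κ f ω) ^ p ∂(sphMeasure n)) ^ (1 / p)

/-- `μ` is a Carleson measure on the unit ball with constant `c`. -/
def IsCarleson (n : ℕ) (c : ℝ) (μ : Measure (Vec n)) : Prop :=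
  ∀ ω ∈ unitSphere n, ∀ r : ℝ, 0 < r →
    μ (unitBall n ∩ Metric.ball ω r) ≤ ENNReal.ofReal c * ENNReal.ofReal r ^ ((n : ℝ) - 1)

/-- `μ` is an `α`-Carleson measure on the unit ball with constant `γ`. -/
def IsAlphaCarleson (n : ℕ) (α γ : ℝ) (μ : Measure (Vec n)) : Prop :=
  ∀ ω ∈ unitSphere n, ∀ r : ℝ, 0 < r →
    μ (unitBall n ∩ Metric.ball ω r) ≤
      ENNReal.ofReal γ * ENNReal.ofReal r ^ (α * ((n : ℝ) - 1))

theorem lintegral_polar {E : Type*} [NormedAddCommGroup E] [NormedSpace ℝ E]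
    [FiniteDimensional ℝ E] [Nontrivial E] [MeasurableSpace E] [BorelSpace E]
    (μ : Measure E) [μ.IsAddHaarMeasure] {φ : E → ℝ≥0∞} (hφ : Measurable φ) :
    ∫⁻ y, φ y ∂μ = ∫⁻ ω : sphere (0 : E) 1, (∫⁻ r in Ioi (0 : ℝ),
      ENNReal.ofReal (r ^ (Module.finrank ℝ E - 1)) * φ (r • (ω : E))) ∂μ.toSphere := by
  have hmp := μ.measurePreserving_homeomorphUnitSphereProd
  have hm1 : Measurable fun q : sphere (0 : E) 1 × Ioi (0 : ℝ) => φ ((q.2 : ℝ) • (q.1 : E)) := by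
    fun_prop
  calc ∫⁻ y, φ y ∂μ = ∫⁻ y in ({0}ᶜ : Set E), φ y ∂μ := by
        rw [restrict_compl_singleton]
    _ = ∫⁻ y : ({0}ᶜ : Set E), φ y ∂(μ.comap (↑)) := by
        rw [lintegral_subtype_comap (measurableSet_singleton _).compl]
    _ = ∫⁻ q, φ ((q.2 : ℝ) • (q.1 : E))
          ∂(μ.toSphere.prod (Measure.volumeIoiPow (Module.finrank ℝ E - 1))) := by
        rw [← hmp.lintegral_comp hm1]
        refine lintegral_congr fun y => ?_
        congr 1
        have := (homeomorphUnitSphereProd E).symm_apply_apply y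
        conv_lhs => rw [← this]
        have hy : ‖(y : E)‖ ≠ 0 := norm_ne_zero_iff.2 y.2
        simp [smul_inv_smul₀ hy]
    _ = _ := by
        rw [lintegral_prod _ hm1.aemeasurable]
        refine lintegral_congr fun ω => ?_
        rw [Measure.volumeIoiPow, lintegral_withDensity_eq_lintegral_mul _ (by fun_prop)
          (by fun_prop)]
        exact lintegral_subtype_comap measurableSet_Ioi
          (fun r : ℝ => ENNReal.ofReal (r ^ (Module.finrank ℝ E - 1)) * φ (r • (ω : E)))

/-- The surface measure of the unit sphere induced by Lebesgue measure. -/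
abbrev coneMeasure (n : ℕ) : Measure (sphere (0 : Vec n) 1) :=
  (volume : Measure (Vec n)).toSphere

theorem setLIntegral_sector_le {n : ℕ} (hn : 2 ≤ n) {φ : Vec n → ℝ≥0∞} (hφ : Measurable φ)
    {E : Set (sphere (0 : Vec n) 1)} (hE : MeasurableSet E) {I : Set ℝ} (hI : MeasurableSet I)
    (hI2 : I ⊆ Icc (1 / 2) 1) {W : Set (Vec n)} (hW : MeasurableSet W)
    (hEW : ∀ ω ∈ E, ∀ r ∈ I, r • (ω : Vec n) ∈ W) :
    ∫⁻ ω in E, (∫⁻ r in I, φ (r • (ω : Vec n))) ∂coneMeasure n ≤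
      ENNReal.ofReal (2 ^ (n - 1)) * ∫⁻ y in W, φ y := by
  have : Nonempty (Fin n) := ⟨⟨0, by omega⟩⟩
  rw [← lintegral_indicator hW, lintegral_polar volume (hφ.indicator hW),
    ← lintegral_const_mul' _ _ ENNReal.ofReal_ne_top, ← lintegral_indicator hE]
  refine lintegral_mono fun ω => ?_
  by_cases hω : ω ∈ E
  swap
  · simp [hω]
  simp only [hω, indicator_of_mem]
  rw [← lintegral_const_mul' _ _ ENNReal.ofReal_ne_top, ← lintegral_indicator hI,
    ← lintegral_indicator measurableSet_Ioi]
  refine lintegral_mono fun r => ?_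
  by_cases hr : r ∈ I
  swap
  · simp [hr]
  have h1 := hI2 hr
  have hr0 : r ∈ Ioi (0 : ℝ) := by
    have := h1.1
    simp only [mem_Ioi]; linarith
  simp only [hr, hr0, indicator_of_mem, hEW ω hω r hr, finrank_euclideanSpace, Fintype.card_fin]
  rw [← mul_assoc, ← ENNReal.ofReal_mul (by positivity), ← mul_pow]
  refine le_mul_of_one_le_left' ?_
  rw [ENNReal.one_le_ofReal]
  exact one_le_pow₀ (by linarith [h1.1])

theorem exists_coneMeasure_le (n : ℕ) (hn : 2 ≤ n) :
    ∃ C : ℝ, 0 < C ∧ ∀ (c : Vec n) (d : ℝ), 0 < d → ∀ E : Set (sphere (0 : Vec n) 1),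
      (∀ ω ∈ E, ‖(ω : Vec n) - c‖ ≤ d) →
      coneMeasure n E ≤ ENNReal.ofReal (C * d ^ (n - 1)) := by
  have : Nonempty (Fin n) := ⟨⟨0, by omega⟩⟩
  obtain ⟨m, rfl⟩ : ∃ m, n = m + 1 := ⟨n - 1, by omega⟩
  set V : ℝ := volume.real (ball (0 : Vec (m + 1)) 1) with hV
  have hV0 : 0 < V := ENNReal.toReal_pos (measure_ball_pos volume _ one_pos).ne' measure_ball_lt_top.ne
  have hVe : volume (ball (0 : Vec (m + 1)) 1) = ENNReal.ofReal V := by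
    rw [hV, Measure.real, ENNReal.ofReal_toReal measure_ball_lt_top.ne]
  refine ⟨(m + 1) * V * 2 ^ m * 2 ^ (m + 1), by positivity, fun c d hd E hE => ?_⟩
  simp only [Nat.add_sub_cancel]
  rcases le_or_gt d (1 / 2) with h | h
  · set E' : Set (sphere (0 : Vec (m + 1)) 1) := {ω | ‖(ω : Vec (m + 1)) - c‖ ≤ d}
    have hE' : MeasurableSet E' := by
      refine (isClosed_le ?_ continuous_const).measurableSet
      fun_prop
    have key := setLIntegral_sector_le (n := m + 1) hn (φ := fun _ => 1) measurable_const hE'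
      (I := Icc (1 - d) 1) measurableSet_Icc (Icc_subset_Icc_left (by linarith))
      (W := closedBall c (2 * d)) measurableSet_closedBall (by
        intro ω hω r hr
        have hω1 : ‖(ω : Vec (m + 1))‖ = 1 := by simp
        rw [mem_closedBall, dist_eq_norm]
        calc ‖r • (ω : Vec (m + 1)) - c‖ = ‖(r - 1) • (ω : Vec (m + 1)) + (ω - c)‖ := by
              congr 1; module
          _ ≤ ‖(r - 1) • (ω : Vec (m + 1))‖ + ‖(ω : Vec (m + 1)) - c‖ := norm_add_le _ _
          _ ≤ d + d := by
              gcongr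
              · rw [norm_smul, hω1, mul_one, Real.norm_eq_abs, abs_le]
                constructor <;> linarith [hr.1, hr.2]
              · exact hω
          _ = 2 * d := by ring)
    simp only [lintegral_const, one_mul, Measure.restrict_apply_univ, Real.volume_Icc,
      sub_sub_cancel, Nat.add_sub_cancel, Measure.addHaar_closedBall _ _ (by positivity : 0 ≤ 2 * d),
      finrank_euclideanSpace, Fintype.card_fin, hVe] at key
    rw [← ENNReal.ofReal_mul (by positivity), ← ENNReal.ofReal_mul (by positivity)] at key
    have hd' : ENNReal.ofReal d ≠ 0 := by simpa using hd
    refine (measure_mono (fun ω hω => hE ω hω : E ⊆ E')).trans ?_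
    rw [← ENNReal.mul_le_mul_iff_right hd' ENNReal.ofReal_ne_top]
    refine key.trans ?_
    rw [← ENNReal.ofReal_mul (by positivity)]
    refine ENNReal.ofReal_le_ofReal ?_
    have : 0 ≤ (m : ℝ) * (V * 2 ^ m * 2 ^ (m + 1) * d ^ (m + 1)) := by positivity
    calc 2 ^ m * ((2 * d) ^ (m + 1) * V) = V * 2 ^ m * 2 ^ (m + 1) * d ^ (m + 1) := by
          rw [mul_pow]; ring
      _ ≤ d * ((m + 1) * V * 2 ^ m * 2 ^ (m + 1) * d ^ m) := by
          ring_nf at this ⊢; linarith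
  · refine (measure_mono (subset_univ _)).trans ?_
    rw [Measure.toSphere_apply_univ, hVe]
    rw [finrank_euclideanSpace, Fintype.card_fin, ← ENNReal.ofReal_natCast,
      ← ENNReal.ofReal_mul (by positivity)]
    refine ENNReal.ofReal_le_ofReal ?_
    have h1 : 1 ≤ (2 * d) ^ m := one_le_pow₀ (by linarith)
    have h2 : (1 : ℝ) ≤ 2 ^ (m + 1) := one_le_pow₀ (by norm_num)
    push_cast
    calc ((m : ℝ) + 1) * V = (m + 1) * V * 1 * 1 := by ring
      _ ≤ (m + 1) * V * (2 * d) ^ m * 2 ^ (m + 1) := by gcongr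
      _ = _ := by rw [mul_pow]; ring

theorem exists_le_coneMeasure (n : ℕ) (hn : 2 ≤ n) :
    ∃ C : ℝ, 0 < C ∧ ∀ (ω₀ : sphere (0 : Vec n) 1) (d : ℝ), 0 < d → d ≤ 1 →
      ENNReal.ofReal (C * d ^ (n - 1)) ≤ coneMeasure n {ω | ‖(ω : Vec n) - ω₀‖ < d} := by
  have : Nonempty (Fin n) := ⟨⟨0, by omega⟩⟩
  obtain ⟨m, rfl⟩ : ∃ m, n = m + 1 := ⟨n - 1, by omega⟩
  set V : ℝ := volume.real (ball (0 : Vec (m + 1)) 1) with hV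
  have hV0 : 0 < V := ENNReal.toReal_pos (measure_ball_pos volume _ one_pos).ne' measure_ball_lt_top.ne
  have hVe : volume (ball (0 : Vec (m + 1)) 1) = ENNReal.ofReal V := by
    rw [hV, Measure.real, ENNReal.ofReal_toReal measure_ball_lt_top.ne]
  refine ⟨V * 4 / 8 ^ (m + 1), by positivity, fun ω₀ d hd hd1 => ?_⟩
  simp only [Nat.add_sub_cancel]
  set E' : Set (sphere (0 : Vec (m + 1)) 1) := {ω | ‖(ω : Vec (m + 1)) - ω₀‖ < d} with hE'def
  have hE' : MeasurableSet E' := by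
    refine (isOpen_lt ?_ continuous_const).measurableSet
    fun_prop
  set c : Vec (m + 1) := (1 - d / 8) • (ω₀ : Vec (m + 1)) with hc
  have hω0 : ‖(ω₀ : Vec (m + 1))‖ = 1 := by simp
  have hvol : volume (ball c (d / 8)) = ENNReal.ofReal ((d / 8) ^ (m + 1) * V) := by
    rw [Measure.addHaar_ball _ _ (by positivity), hVe, finrank_euclideanSpace, Fintype.card_fin,
      ← ENNReal.ofReal_mul (by positivity)]
  have hle : volume (ball c (d / 8)) ≤ coneMeasure (m + 1) E' * ENNReal.ofReal (d / 4) := by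
    rw [← lintegral_indicator_one measurableSet_ball,
      lintegral_polar _ (measurable_one.indicator measurableSet_ball)]
    calc _ ≤ ∫⁻ ω, E'.indicator (fun _ => ENNReal.ofReal (d / 4)) ω ∂coneMeasure (m + 1) := by
          refine lintegral_mono fun ω => ?_
          have hω1 : ‖(ω : Vec (m + 1))‖ = 1 := by simp
          have hin : ∀ r ∈ Ioi (0 : ℝ), r • (ω : Vec (m + 1)) ∈ ball c (d / 8) →
              ω ∈ E' ∧ r ∈ Ioc (1 - d / 4) 1 := by
            intro r hr hb
            rw [mem_ball, dist_eq_norm] at hb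
            have hr0 : 0 < r := hr
            have hn1 : ‖r • (ω : Vec (m + 1))‖ = r := by
              rw [norm_smul, hω1, mul_one, Real.norm_of_nonneg hr0.le]
            have hn2 : ‖c‖ = 1 - d / 8 := by
              rw [hc, norm_smul, hω0, mul_one, Real.norm_of_nonneg (by linarith)]
            have h3 := abs_le.1 ((abs_norm_sub_norm_le (r • (ω : Vec (m + 1))) c).trans hb.le)
            rw [hn1, hn2] at h3
            have hb1 : |r - (1 - d / 8)| < d / 8 := by
              rw [← hn1, ← hn2]
              exact (abs_norm_sub_norm_le _ _).trans_lt hb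
            rw [abs_lt] at hb1
            refine ⟨?_, ?_, by linarith⟩
            · rw [hE'def, mem_ofPred_eq]
              calc ‖(ω : Vec (m + 1)) - ω₀‖ = ‖(1 - r) • (ω : Vec (m + 1)) + (r • (ω : Vec (m + 1)) - c)
                    + (- (d / 8)) • (ω₀ : Vec (m + 1))‖ := by
                    congr 1; rw [hc]; module
                _ ≤ ‖(1 - r) • (ω : Vec (m + 1))‖ + ‖r • (ω : Vec (m + 1)) - c‖
                    + ‖(- (d / 8)) • (ω₀ : Vec (m + 1))‖ := norm_add₃_le
                _ < d / 4 + d / 8 + d / 8 := by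
                    rw [norm_smul, norm_smul, hω1, hω0, Real.norm_of_nonneg (by linarith), norm_neg,
                      Real.norm_of_nonneg (by linarith)]
                    linarith
                _ ≤ d := by linarith
            · linarith
          rw [← lintegral_indicator measurableSet_Ioi]
          by_cases hω : ω ∈ E'
          · simp only [hω, indicator_of_mem]
            calc _ ≤ ∫⁻ r, (Ioc (1 - d / 4) 1).indicator (fun _ => 1) r := by
                  refine lintegral_mono fun r => ?_
                  by_cases hr : r ∈ Ioi (0 : ℝ)
                  · by_cases hb : r • (ω : Vec (m + 1)) ∈ ball c (d / 8)
                    · have h4 := (hin r hr hb).2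
                      have hr0 : 0 < r := hr
                      simp only [hr, hb, h4, indicator_of_mem, Pi.one_apply, mul_one,
                        ENNReal.ofReal_le_one]
                      exact pow_le_one₀ hr0.le h4.2
                    · simp [indicator, hb]
                  · simp [hr]
              _ = ENNReal.ofReal (d / 4) := by
                  rw [lintegral_indicator measurableSet_Ioc]; simp
          · have : ∀ r : ℝ, (Ioi (0 : ℝ)).indicator (fun r => ENNReal.ofReal
              (r ^ (Module.finrank ℝ (Vec (m + 1)) - 1)) *
                (ball c (d / 8)).indicator 1 (r • (ω : Vec (m + 1)))) r = 0 := by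
              intro r
              by_cases hr : r ∈ Ioi (0 : ℝ)
              · have : r • (ω : Vec (m + 1)) ∉ ball c (d / 8) := fun hb => hω (hin r hr hb).1
                simp [this]
              · simp [hr]
            simp only [this, lintegral_zero, zero_le]
      _ = _ := by
          rw [lintegral_indicator hE', lintegral_const, Measure.restrict_apply_univ, mul_comm]
  rw [hvol] at hle
  have hd' : ENNReal.ofReal (d / 4) ≠ 0 := by simpa using hd
  rw [← ENNReal.mul_le_mul_iff_left hd' ENNReal.ofReal_ne_top]
  refine le_trans (le_of_eq ?_) hle
  rw [← ENNReal.ofReal_mul (by positivity)]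
  congr 1
  rw [div_pow]; field_simp; ring

theorem exists_map_coneMeasure_le (n : ℕ) (hn : 2 ≤ n) :
    ∃ C : ℝ, 0 < C ∧
      (coneMeasure n).map Subtype.val ≤ ENNReal.ofReal C • sphMeasure n := by
  obtain ⟨C, hC, h⟩ := exists_coneMeasure_le n hn
  have hemb : MeasurableEmbedding (Subtype.val : sphere (0 : Vec n) 1 → Vec n) :=
    MeasurableEmbedding.subtype_coe isClosed_sphere.measurableSet
  refine ⟨C, hC, ?_⟩
  set ν := (coneMeasure n).map Subtype.val
  have hC0 : ENNReal.ofReal C ≠ 0 := by simpa using hC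
  have hle : (ENNReal.ofReal C)⁻¹ • ν ≤ μH[(n : ℝ) - 1] := by
    refine Measure.le_hausdorffMeasure _ _ 1 one_pos fun s hs => ?_
    rw [Measure.smul_apply, smul_eq_mul, ← ENNReal.div_eq_inv_mul,
      ENNReal.div_le_iff hC0 ENNReal.ofReal_ne_top, hemb.map_apply]
    rcases (Subtype.val ⁻¹' s : Set (sphere (0 : Vec n) 1)).eq_empty_or_nonempty with he | ⟨ω₀, h₀⟩
    · simp [he]
    have hfin : ediam s ≠ ⊤ := (hs.trans_lt ENNReal.one_lt_top).ne
    set d := (ediam s).toReal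
    have hd : 0 ≤ d := ENNReal.toReal_nonneg
    have hed : ediam s = ENNReal.ofReal d := (ENNReal.ofReal_toReal hfin).symm
    have hlim : Tendsto (fun t : ℝ => ENNReal.ofReal (C * t ^ (n - 1))) (𝓝[>] d)
        (𝓝 (ENNReal.ofReal (C * d ^ (n - 1)))) := by
      refine (Continuous.tendsto ?_ d).mono_left nhdsWithin_le_nhds
      exact ENNReal.continuous_ofReal.comp (by fun_prop)
    have hb : coneMeasure n (Subtype.val ⁻¹' s) ≤ ENNReal.ofReal (C * d ^ (n - 1)) := by
      refine ge_of_tendsto hlim ?_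
      filter_upwards [self_mem_nhdsWithin] with t ht
      have ht : d < t := ht
      refine h ω₀ t (hd.trans_lt ht) _ fun ω hω => ?_
      rw [← dist_eq_norm]
      refine le_trans ?_ ht.le
      rw [← ENNReal.ofReal_le_ofReal_iff hd, ← hed, ← edist_dist]
      exact edist_le_ediam_of_mem hω h₀
    refine hb.trans (le_of_eq ?_)
    have hn1 : ((n : ℝ) - 1) = ((n - 1 : ℕ) : ℝ) := by
      rw [Nat.cast_sub (by omega)]; simp
    rw [hn1, ENNReal.rpow_natCast, hed, ← ENNReal.ofReal_pow hd, ← ENNReal.ofReal_mul (by positivity),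
      mul_comm]
  have hle2 : ν ≤ ENNReal.ofReal C • μH[(n : ℝ) - 1] := by
    have := fun s => mul_le_mul_right (hle s) (ENNReal.ofReal C)
    refine Measure.le_iff'.2 fun s => ?_
    have h3 := this s
    rwa [Measure.smul_apply, smul_eq_mul, ← mul_assoc, ENNReal.mul_inv_cancel hC0
      ENNReal.ofReal_ne_top, one_mul] at h3
  have hν : ν = ν.restrict (unitSphere n) := by
    refine (Measure.restrict_eq_self_of_ae_mem ?_).symm
    rw [hemb.ae_map_iff]
    exact Eventually.of_forall fun ω => ω.2
  rw [hν, sphMeasure, ← Measure.restrict_smul]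
  exact Measure.restrict_mono subset_rfl hle2

theorem exists_hausdorffMeasure_hyperplane_le (n : ℕ) (hn : 2 ≤ n) :
    ∃ C : ℝ, 0 < C ∧ ∀ L : Submodule ℝ (Vec n), Module.finrank ℝ L = n - 1 →
      ∀ (c : Vec n) (d : ℝ), 0 < d →
        (μH[(n : ℝ) - 1] : Measure (Vec n)) ((L : Set (Vec n)) ∩ ball c d) ≤
          ENNReal.ofReal (C * d ^ (n - 1)) := by
  let F := EuclideanSpace ℝ (Fin (n - 1))
  have hn1 : ((n : ℝ) - 1) = ((Module.finrank ℝ F : ℕ) : ℝ) := by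
    rw [finrank_euclideanSpace, Fintype.card_fin, Nat.cast_sub (by omega)]; simp
  set μ : Measure F := μH[Module.finrank ℝ F] with hμ
  set V : ℝ := μ.real (ball (0 : F) 1) with hV
  have hV0 : 0 < V := ENNReal.toReal_pos (measure_ball_pos μ _ one_pos).ne' measure_ball_lt_top.ne
  have hVe : μ (ball (0 : F) 1) = ENNReal.ofReal V := by
    rw [hV, Measure.real, ENNReal.ofReal_toReal measure_ball_lt_top.ne]
  refine ⟨2 ^ (n - 1) * V, by positivity, fun L hL c d hd => ?_⟩
  rcases ((L : Set (Vec n)) ∩ ball c d).eq_empty_or_nonempty with he | ⟨x₀, hx₀L, hx₀⟩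
  · simp [he]
  let e : L ≃ₗᵢ[ℝ] F := ((stdOrthonormalBasis ℝ L).reindex (finCongr hL)).repr
  let ι : F → Vec n := fun v => (e.symm v : Vec n)
  have hι : Isometry ι := isometry_subtype_coe.comp e.symm.isometry
  have hsub : (L : Set (Vec n)) ∩ ball c d ⊆ ι '' ball (e ⟨x₀, hx₀L⟩) (2 * d) := by
    rintro y ⟨hyL, hy⟩
    refine ⟨e ⟨y, hyL⟩, ?_, by simp [ι]⟩
    rw [mem_ball, e.isometry.dist_eq, Subtype.dist_eq]
    calc dist y x₀ ≤ dist y c + dist x₀ c := dist_triangle_right _ _ _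
      _ < d + d := add_lt_add hy hx₀
      _ = 2 * d := by ring
  refine (measure_mono hsub).trans ?_
  rw [hι.hausdorffMeasure_image (Or.inl (by rw [hn1]; positivity)), hn1, ← hμ,
    Measure.addHaar_ball_of_pos _ _ (by positivity), hVe, finrank_euclideanSpace, Fintype.card_fin,
    ← ENNReal.ofReal_mul (by positivity)]
  refine ENNReal.ofReal_le_ofReal (le_of_eq ?_)
  rw [mul_pow]; ring

theorem lintegral_abs_det_fderiv_mul_le_of_encard_fiber_le {E : Type*} [NormedAddCommGroup E]
    [NormedSpace ℝ E] [FiniteDimensional ℝ E] [MeasurableSpace E] [BorelSpace E]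
    (μ : Measure E) [μ.IsAddHaarMeasure] {f : E → E} {f' : E → E →L[ℝ] E} {s : Set E}
    (hs : MeasurableSet s) (hf' : ∀ x ∈ s, HasFDerivWithinAt f (f' x) s x)
    (hdet : ∀ x ∈ s, (f' x).det ≠ 0) {N : ℝ≥0∞}
    (hN : ∀ y, (({x ∈ s | f x = y}).encard : ℝ≥0∞) ≤ N) {φ : E → ℝ≥0∞} (hφ : Measurable φ)
    {Z : Set E} (hZ : ∀ x ∈ s, f x ∈ Z) :
    ∫⁻ x in s, ENNReal.ofReal |(f' x).det| * φ (f x) ∂μ ≤ N * ∫⁻ y in Z, φ y ∂μ := by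
  have hr : ∀ A : E →L[ℝ] E, ∃ c : ℝ≥0, c ≠ 0 ∧ (A.det ≠ 0 → ∀ t : Set E,
      ApproximatesLinearOn f A t c → InjOn f t) := by
    intro A
    by_cases hA : A.det = 0
    · exact ⟨1, one_ne_zero, fun h => (h hA).elim⟩
    · let B := A.toContinuousLinearEquivOfDetNeZero hA
      rcases subsingleton_or_nontrivial E with hE | hE
      · exact ⟨1, one_ne_zero, fun _ t _ => injOn_of_subsingleton _ _⟩
      have hpos : 0 < ‖(B.symm : E →L[ℝ] E)‖₊⁻¹ := inv_pos.2 B.nnnorm_symm_pos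
      obtain ⟨c, hc0, hc⟩ := exists_between hpos
      refine ⟨c, hc0.ne', fun _ t ht => ?_⟩
      have : ApproximatesLinearOn f (B : E →L[ℝ] E) t c := ht
      exact this.injOn (Or.inr hc)
  choose r hr0 hrinj using hr
  obtain ⟨t, A, tdisj, tmeas, tcov, tapp, tA⟩ :=
    exists_partition_approximatesLinearOn_of_hasFDerivWithinAt f s f' hf' r hr0
  have hinj : ∀ k, InjOn f (s ∩ t k) := by
    intro k
    rcases s.eq_empty_or_nonempty with h | h
    · simp [h]
    obtain ⟨y, hy, hAy⟩ := tA h k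
    exact hrinj (A k) (hAy ▸ hdet y hy) _ (tapp k)
  have hmeas : ∀ k, MeasurableSet (s ∩ t k) := fun k => hs.inter (tmeas k)
  have hd : ∀ k, ∀ x ∈ s ∩ t k, HasFDerivWithinAt f (f' x) (s ∩ t k) x := fun k x hx =>
    (hf' x hx.1).mono inter_subset_left
  have himg : ∀ k, MeasurableSet (f '' (s ∩ t k)) := fun k =>
    measurable_image_of_fderivWithin (hmeas k) (hd k) (hinj k)
  have hcov : s = ⋃ k, s ∩ t k := by
    rw [← inter_iUnion, inter_eq_left.2 tcov]
  have hcount : ∀ y, ∑' k, (f '' (s ∩ t k)).indicator (fun _ => (1 : ℝ≥0∞)) y ≤ N := by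
    intro y
    refine ENNReal.tsum_le_of_sum_range_le fun m => ?_
    refine le_trans ?_ (hN y)
    set P := (Finset.range m).filter fun k => y ∈ f '' (s ∩ t k) with hP
    have h1 : ∑ k ∈ Finset.range m, (f '' (s ∩ t k)).indicator (fun _ => (1 : ℝ≥0∞)) y
        = (P.card : ℝ≥0∞) := by
      simp [indicator, hP]
    rw [h1]
    have h2 : ∀ k : P, ∃ x, x ∈ s ∩ t k ∧ f x = y := fun k => (Finset.mem_filter.1 k.2).2
    choose x hx hxy using h2
    have hxinj : Function.Injective x := by
      intro k l hkl
      by_contra hne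
      have := tdisj (fun h => hne (Subtype.ext h) : (k : ℕ) ≠ l)
      exact disjoint_left.1 this (hx k).2 (hkl ▸ (hx l).2)
    have h3 : (P.card : ℕ∞) ≤ ({x ∈ s | f x = y}).encard := by
      calc (P.card : ℕ∞) = (univ : Set P).encard := by simp
        _ = (range x).encard := by rw [← image_univ, hxinj.encard_image]
        _ ≤ _ := encard_le_encard (by rintro _ ⟨k, rfl⟩; exact ⟨(hx k).1, hxy k⟩)
    exact_mod_cast (ENat.toENNReal_le.2 h3)
  calc ∫⁻ x in s, ENNReal.ofReal |(f' x).det| * φ (f x) ∂μ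
      = ∑' k, ∫⁻ x in s ∩ t k, ENNReal.ofReal |(f' x).det| * φ (f x) ∂μ := by
        conv_lhs => rw [hcov]
        exact lintegral_iUnion hmeas
          (fun k l hkl => (tdisj hkl).mono inter_subset_right inter_subset_right) _
    _ = ∑' k, ∫⁻ y in f '' (s ∩ t k), φ y ∂μ := by
        congr 1; ext k
        rw [lintegral_image_eq_lintegral_abs_det_fderiv_mul μ (hmeas k) (hd k) (hinj k)]
    _ ≤ ∑' k, ∫⁻ y in Z, (f '' (s ∩ t k)).indicator (fun _ => (1 : ℝ≥0∞)) y * φ y ∂μ := by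
        refine ENNReal.tsum_le_tsum fun k => ?_
        calc ∫⁻ y in f '' (s ∩ t k), φ y ∂μ
            = ∫⁻ y in f '' (s ∩ t k) ∩ Z, φ y ∂μ := by
              have : f '' (s ∩ t k) ⊆ Z := by
                rintro _ ⟨x, hx, rfl⟩
                exact hZ x hx.1
              rw [inter_eq_left.2 this]
          _ = ∫⁻ y in Z, (f '' (s ∩ t k)).indicator φ y ∂μ := by
              rw [lintegral_indicator (himg k), Measure.restrict_restrict (himg k)]
          _ ≤ _ := by
              refine lintegral_mono fun y => ?_
              by_cases h : y ∈ f '' (s ∩ t k) <;> simp [h, -mem_image]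
    _ = ∫⁻ y in Z, ∑' k, (f '' (s ∩ t k)).indicator (fun _ => (1 : ℝ≥0∞)) y * φ y ∂μ := by
        rw [lintegral_tsum]
        exact fun k => ((measurable_const.indicator (himg k)).mul hφ).aemeasurable
    _ ≤ ∫⁻ y in Z, N * φ y ∂μ := by
        refine lintegral_mono fun y => ?_
        simp only [ENNReal.tsum_mul_right]
        gcongr
        exact hcount y
    _ = N * ∫⁻ y in Z, φ y ∂μ := lintegral_const_mul _ hφ

theorem mobiusT_eq (n : ℕ) (x y : Vec n) :
    mobiusT n x y = (1 - 2 * inner ℝ x y + ‖x‖ ^ 2 * ‖y‖ ^ 2)⁻¹ •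
      ((1 - ‖x‖ ^ 2) • y - (1 - 2 * inner ℝ x y + ‖y‖ ^ 2) • x) := by
  unfold mobiusT
  split_ifs with h
  · simp [h]
  have hx : ‖x‖ ≠ 0 := norm_ne_zero_iff.2 h
  have h1 : ‖x‖ ^ 2 * ‖y - (‖x‖ ^ 2)⁻¹ • x‖ ^ 2 = 1 - 2 * inner ℝ x y + ‖x‖ ^ 2 * ‖y‖ ^ 2 := by
    rw [norm_sub_sq_real, inner_smul_right, norm_smul, real_inner_comm, norm_inv, norm_pow, norm_norm]
    field_simp
    ring
  have h2 : ‖y - x‖ ^ 2 = ‖y‖ ^ 2 - 2 * inner ℝ x y + ‖x‖ ^ 2 := by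
    rw [norm_sub_sq_real, real_inner_comm]
  rw [h1, h2]
  congr 1
  module

theorem mobiusT_denom_eq {n : ℕ} (x y : Vec n) :
    1 - 2 * inner ℝ x y + ‖x‖ ^ 2 * ‖y‖ ^ 2 =
      ‖y - x‖ ^ 2 + (1 - ‖x‖ ^ 2) * (1 - ‖y‖ ^ 2) := by
  rw [norm_sub_sq_real, real_inner_comm]; ring

theorem one_sub_norm_sq_pos {n : ℕ} {x : Vec n} (hx : x ∈ unitBall n) : 0 < 1 - ‖x‖ ^ 2 := by
  have : ‖x‖ < 1 := by simpa [unitBall] using hx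
  nlinarith [norm_nonneg x]

theorem mobiusT_denom_pos {n : ℕ} {x y : Vec n} (hx : x ∈ unitBall n) (hy : y ∈ unitBall n) :
    0 < 1 - 2 * inner ℝ x y + ‖x‖ ^ 2 * ‖y‖ ^ 2 := by
  rw [mobiusT_denom_eq]
  have := mul_pos (one_sub_norm_sq_pos hx) (one_sub_norm_sq_pos hy)
  positivity

theorem norm_mobiusT_sq {n : ℕ} {x y : Vec n} (hx : x ∈ unitBall n) (hy : y ∈ unitBall n) :
    ‖mobiusT n x y‖ ^ 2 = (‖y‖ ^ 2 - 2 * inner ℝ x y + ‖x‖ ^ 2) /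
      (1 - 2 * inner ℝ x y + ‖x‖ ^ 2 * ‖y‖ ^ 2) := by
  have hD := mobiusT_denom_pos hx hy
  rw [mobiusT_eq, norm_smul, mul_pow, norm_sub_sq_real, norm_smul, norm_smul, inner_smul_left,
    inner_smul_right, real_inner_comm x y]
  simp only [mul_pow, Real.norm_eq_abs, sq_abs, conj_trivial]
  set c := inner ℝ x y
  set D := 1 - 2 * c + ‖x‖ ^ 2 * ‖y‖ ^ 2 with hDdef
  field_simp
  rw [hDdef]
  ring

theorem mobiusT_neg_mobiusT {n : ℕ} {x y : Vec n} (hx : x ∈ unitBall n) (hy : y ∈ unitBall n) :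
    mobiusT n (-x) (mobiusT n x y) = y := by
  have hD := mobiusT_denom_pos hx hy
  have ha := one_sub_norm_sq_pos hx
  have hb := norm_mobiusT_sq hx hy
  have hc : inner ℝ x (mobiusT n x y) = ((1 - ‖x‖ ^ 2) * inner ℝ x y -
      (1 - 2 * inner ℝ x y + ‖y‖ ^ 2) * ‖x‖ ^ 2) /
      (1 - 2 * inner ℝ x y + ‖x‖ ^ 2 * ‖y‖ ^ 2) := by
    rw [mobiusT_eq, inner_smul_right, inner_sub_right, inner_smul_right, inner_smul_right,
      real_inner_self_eq_norm_sq]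
    field_simp
  rw [mobiusT_eq n (-x), norm_neg, inner_neg_left, hb, hc, mobiusT_eq]
  set c := inner ℝ x y
  set D := 1 - 2 * c + ‖x‖ ^ 2 * ‖y‖ ^ 2 with hDdef
  have h1 : 1 - 2 * -(((1 - ‖x‖ ^ 2) * c - (1 - 2 * c + ‖y‖ ^ 2) * ‖x‖ ^ 2) / D) +
      ‖x‖ ^ 2 * ((‖y‖ ^ 2 - 2 * c + ‖x‖ ^ 2) / D) = (1 - ‖x‖ ^ 2) ^ 2 / D := by
    field_simp
    rw [hDdef]; ring
  have h2 : 1 - 2 * -(((1 - ‖x‖ ^ 2) * c - (1 - 2 * c + ‖y‖ ^ 2) * ‖x‖ ^ 2) / D) +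
      ((‖y‖ ^ 2 - 2 * c + ‖x‖ ^ 2) / D) = (1 - ‖x‖ ^ 2) * (1 - 2 * c + ‖y‖ ^ 2) / D := by
    field_simp
    rw [hDdef]; ring
  rw [h1, h2]
  match_scalars
  · field_simp
  · field_simp
    ring

theorem mobiusT_neg_zero {n : ℕ} (x : Vec n) : mobiusT n (-x) 0 = x := by
  simp [mobiusT_eq]

theorem one_sub_norm_mobiusT_ge {n : ℕ} {x y : Vec n} (hx : x ∈ unitBall n) (hy : y ∈ unitBall n)
    {t : ℝ} (ht : 0 ≤ t) (hxy : ‖y - x‖ ≤ 4 * (1 - ‖x‖)) (hyt : t * (1 - ‖x‖) ≤ 1 - ‖y‖) :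
    t / 72 ≤ 1 - ‖mobiusT n x y‖ := by
  have hD := mobiusT_denom_pos hx hy
  have hx1 : ‖x‖ < 1 := by simpa [unitBall] using hx
  have hy1 : ‖y‖ < 1 := by simpa [unitBall] using hy
  have hx0 := norm_nonneg x
  have hy0 := norm_nonneg y
  have hz := norm_mobiusT_sq hx hy
  have hDle : 1 - 2 * inner ℝ x y + ‖x‖ ^ 2 * ‖y‖ ^ 2 ≤ 36 * (1 - ‖x‖) ^ 2 := by
    rw [mobiusT_denom_eq]
    have h1 : ‖x‖ ≤ ‖y‖ + ‖y - x‖ := by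
      have := norm_sub_norm_le x y
      rw [norm_sub_rev] at this; linarith
    have h2 : 1 - ‖y‖ ^ 2 ≤ 10 * (1 - ‖x‖) := by nlinarith
    have h3 : ‖y - x‖ ^ 2 ≤ (4 * (1 - ‖x‖)) ^ 2 := by gcongr
    have h4 : 1 - ‖x‖ ^ 2 ≤ 2 * (1 - ‖x‖) := by nlinarith
    have h5 : (1 - ‖x‖ ^ 2) * (1 - ‖y‖ ^ 2) ≤ (2 * (1 - ‖x‖)) * (10 * (1 - ‖x‖)) :=
      mul_le_mul h4 h2 (one_sub_norm_sq_pos hy).le (by linarith)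
    nlinarith
  have key : t / 36 ≤ 1 - ‖mobiusT n x y‖ ^ 2 := by
    have h6 : 1 - ‖mobiusT n x y‖ ^ 2 = (1 - ‖x‖ ^ 2) * (1 - ‖y‖ ^ 2) /
        (1 - 2 * inner ℝ x y + ‖x‖ ^ 2 * ‖y‖ ^ 2) := by
      rw [hz, eq_div_iff hD.ne', sub_mul, div_mul_cancel₀ _ hD.ne']; ring
    rw [h6, div_le_div_iff₀ (by norm_num) hD]
    have h7 : 1 - ‖x‖ ≤ 1 - ‖x‖ ^ 2 := by nlinarith
    have h8 : t * (1 - ‖x‖) ≤ 1 - ‖y‖ ^ 2 := by nlinarith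
    have h9 : (1 - ‖x‖) * (t * (1 - ‖x‖)) ≤ (1 - ‖x‖ ^ 2) * (1 - ‖y‖ ^ 2) :=
      mul_le_mul h7 h8 (mul_nonneg ht (by linarith)) (one_sub_norm_sq_pos hx).le
    nlinarith [mul_le_mul_of_nonneg_left hDle ht]
  have hz0 := norm_nonneg (mobiusT n x y)
  have hz1 : ‖mobiusT n x y‖ ≤ 1 := by nlinarith
  nlinarith

theorem exists_lintegral_norm_rpow_neg_le (n : ℕ) (hn : 2 ≤ n) {s : ℝ} (hs : 0 < s) :
    ∃ C : ℝ, 0 < C ∧ ∀ m : ℝ, 0 < m →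
      ∫⁻ z in {z : Vec n | m ≤ ‖z‖}, ENNReal.ofReal (‖z‖ ^ (-(n * (1 + s)))) ≤
        ENNReal.ofReal (C * m ^ (-(n * s))) := by
  have : Nonempty (Fin n) := ⟨⟨0, by omega⟩⟩
  have hn0 : (0 : ℝ) < n := by positivity
  set T : ℝ := (coneMeasure n).real univ with hT
  have hT0 : 0 ≤ T := measureReal_nonneg
  have hTe : coneMeasure n univ = ENNReal.ofReal T := by
    rw [hT, Measure.real, ENNReal.ofReal_toReal (measure_ne_top _ _)]
  refine ⟨(T + 1) / (n * s), by positivity, fun m hm => ?_⟩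
  have hW : MeasurableSet {z : Vec n | m ≤ ‖z‖} :=
    (isClosed_le continuous_const continuous_norm).measurableSet
  rw [← lintegral_indicator hW, lintegral_polar volume
    (Measurable.indicator (by fun_prop) hW)]
  have hrad : ∀ ω : sphere (0 : Vec n) 1, ∫⁻ r in Ioi (0 : ℝ),
      ENNReal.ofReal (r ^ (Module.finrank ℝ (Vec n) - 1)) *
        {z : Vec n | m ≤ ‖z‖}.indicator (fun z => ENNReal.ofReal (‖z‖ ^ (-(n * (1 + s)))))
          (r • (ω : Vec n)) ≤ ENNReal.ofReal (m ^ (-(n * s)) / (n * s)) := by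
    intro ω
    have hω1 : ‖(ω : Vec n)‖ = 1 := by simp
    have hlt : -(n * s) - 1 < -1 := by
      have := mul_pos hn0 hs
      linarith
    calc _ ≤ ∫⁻ r, (Ici m).indicator (fun r : ℝ => ENNReal.ofReal (r ^ (-(n * s) - 1))) r := by
          rw [← lintegral_indicator measurableSet_Ioi]
          refine lintegral_mono fun r => ?_
          by_cases hr : r ∈ Ioi (0 : ℝ)
          swap
          · simp [indicator, hr]
          have hr0 : 0 < r := hr
          have hnr : ‖r • (ω : Vec n)‖ = r := by
            rw [norm_smul, hω1, mul_one, Real.norm_of_nonneg hr0.le]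
          by_cases hmr : m ≤ r
          · simp only [indicator, hr, if_true, mem_ofPred_eq, hnr, hmr, mem_Ici,
              finrank_euclideanSpace, Fintype.card_fin]
            rw [← ENNReal.ofReal_mul (by positivity), ← Real.rpow_natCast, ← Real.rpow_add hr0,
              Nat.cast_sub (by omega)]
            refine ENNReal.ofReal_le_ofReal (le_of_eq ?_)
            congr 1
            push_cast; ring
          · simp [indicator, hnr, hmr]
      _ = ∫⁻ r in Ioi m, ENNReal.ofReal (r ^ (-(n * s) - 1)) := by
          rw [lintegral_indicator measurableSet_Ici, setLIntegral_congr Ioi_ae_eq_Ici.symm]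
      _ = ENNReal.ofReal (∫ r in Ioi m, r ^ (-(n * s) - 1)) := by
          rw [ofReal_integral_eq_lintegral_ofReal (integrableOn_Ioi_rpow_of_lt hlt hm)]
          filter_upwards [ae_restrict_mem measurableSet_Ioi] with r hr
          have : 0 < r := hm.trans hr
          positivity
      _ = _ := by
          rw [integral_Ioi_rpow_of_lt hlt hm]
          congr 1
          rw [sub_add_cancel, neg_div_neg_eq]
  refine (lintegral_mono hrad).trans ?_
  rw [lintegral_const, hTe, ← ENNReal.ofReal_mul (by positivity)]
  refine ENNReal.ofReal_le_ofReal ?_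
  have : 0 ≤ m ^ (-(n * s)) / (n * s) := by positivity
  calc m ^ (-(n * s)) / (n * s) * T ≤ m ^ (-(n * s)) / (n * s) * (T + 1) := by gcongr; linarith
    _ = _ := by ring

/-- Up to the factor `s`, an upper bound for `|∇ ‖f‖^(-s)|` on the unit ball. -/
def negPowGradient (n : ℕ) (s : ℝ) (f : Vec n → Vec n) : Vec n → ℝ≥0∞ :=
  (unitBall n).indicator fun y => ENNReal.ofReal (‖f y‖ ^ (-(1 + s)) * ‖fderiv ℝ f y‖)

theorem measurableSet_unitBall (n : ℕ) : MeasurableSet (unitBall n) := measurableSet_ball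

theorem measurable_indicator_unitBall {n : ℕ} {f : Vec n → Vec n}
    (hf : ContinuousOn f (unitBall n)) : Measurable ((unitBall n).indicator f) := by
  classical
  rw [← piecewise_eq_indicator]
  exact hf.measurable_piecewise continuousOn_const (measurableSet_unitBall n)

theorem measurable_negPowGradient {n : ℕ} {s : ℝ} {f : Vec n → Vec n}
    (hf : ContinuousOn f (unitBall n)) : Measurable (negPowGradient n s f) := by
  have h : negPowGradient n s f = (unitBall n).indicator fun y =>
      ENNReal.ofReal (‖(unitBall n).indicator f y‖ ^ (-(1 + s)) * ‖fderiv ℝ f y‖) := by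
    ext y
    by_cases hy : y ∈ unitBall n <;> simp [negPowGradient, hy]
  rw [h]
  refine Measurable.indicator ?_ (measurableSet_unitBall n)
  have h1 := measurable_indicator_unitBall hf
  have h2 := measurable_fderiv ℝ f
  exact ((h1.norm.pow_const _).mul h2.norm).ennreal_ofReal

theorem exists_hasDerivAt_norm_rpow_neg {n : ℕ} {s : ℝ} (hs : 0 < s) {f : Vec n → Vec n}
    {ω : Vec n} (hω : ‖ω‖ = 1) {r : ℝ} (hd : DifferentiableAt ℝ f (r • ω)) (h0 : f (r • ω) ≠ 0) :
    ∃ c : ℝ, HasDerivAt (fun r : ℝ => ‖f (r • ω)‖ ^ (-s)) c r ∧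
      |c| ≤ s * (‖f (r • ω)‖ ^ (-(1 + s)) * ‖fderiv ℝ f (r • ω)‖) := by
  have hpos : 0 < ‖f (r • ω)‖ := norm_pos_iff.2 h0
  have h1 : HasDerivAt (fun r : ℝ => r • ω) ω r := by
    simpa using (hasDerivAt_id r).smul_const ω
  have h2 : HasDerivAt (fun r : ℝ => f (r • ω)) (fderiv ℝ f (r • ω) ω) r :=
    hd.hasFDerivAt.comp_hasDerivAt r h1
  have h3 := h2.norm_sq.rpow_const (p := -s / 2) (Or.inl (by positivity))
  have hfun : (fun r : ℝ => ‖f (r • ω)‖ ^ (-s)) = fun r : ℝ => (‖f (r • ω)‖ ^ 2) ^ (-s / 2) := by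
    ext q
    rw [← Real.rpow_natCast, ← Real.rpow_mul (norm_nonneg _)]
    congr 1; push_cast; ring
  refine ⟨_, hfun ▸ h3, ?_⟩
  have h4 : |inner ℝ (f (r • ω)) (fderiv ℝ f (r • ω) ω)| ≤
      ‖f (r • ω)‖ * ‖fderiv ℝ f (r • ω)‖ := by
    refine (abs_real_inner_le_norm _ _).trans ?_
    gcongr
    simpa [hω] using (fderiv ℝ f (r • ω)).le_opNorm ω
  have h5 : (‖f (r • ω)‖ ^ 2) ^ (-s / 2 - 1) = ‖f (r • ω)‖ ^ (-s - 2) := by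
    rw [← Real.rpow_natCast, ← Real.rpow_mul (norm_nonneg _)]
    congr 1; push_cast; ring
  have h6 : ‖f (r • ω)‖ ^ (-(1 + s)) = ‖f (r • ω)‖ * ‖f (r • ω)‖ ^ (-s - 2) := by
    conv_rhs => rw [← Real.rpow_one_add' (norm_nonneg _) (by linarith)]
    congr 1; ring
  rw [h5, h6, abs_mul, abs_mul, abs_mul, abs_of_nonneg (Real.rpow_nonneg (norm_nonneg _) _),
    abs_of_neg (by linarith : -s / 2 < 0), abs_two]
  have h7 : 0 ≤ s * ‖f (r • ω)‖ ^ (-s - 2) := by positivity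
  nlinarith [mul_le_mul_of_nonneg_left h4 h7]

theorem norm_rpow_neg_le_add_lintegral {n : ℕ} {s : ℝ} (hs : 0 < s) {f : Vec n → Vec n}
    (hc : ContinuousOn f (unitBall n))
    (hd : ∀ x ∈ unitBall n, DifferentiableAt ℝ f x) (h0 : ∀ x ∈ unitBall n, f x ≠ 0)
    {ω : Vec n} (hω : ‖ω‖ = 1) {r₀ r₁ : ℝ} (hr₀ : 0 ≤ r₀) (hr : r₀ ≤ r₁) (hr₁ : r₁ < 1) :
    ENNReal.ofReal (‖f (r₁ • ω)‖ ^ (-s)) ≤ ENNReal.ofReal (‖f (r₀ • ω)‖ ^ (-s)) +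
      ENNReal.ofReal s * ∫⁻ r in Ioo r₀ 1, negPowGradient n s f (r • ω) := by
  set G := ∫⁻ r in Ioo r₀ 1, negPowGradient n s f (r • ω) with hG
  by_cases hfin : G = ⊤
  · rw [hfin, ENNReal.mul_top (by simpa using hs)]; simp
  have hball : ∀ r ∈ Icc r₀ r₁, r • ω ∈ unitBall n := by
    intro r hr
    have : 0 ≤ r := hr₀.trans hr.1
    rw [unitBall, mem_ball_zero_iff, norm_smul, hω, mul_one, Real.norm_of_nonneg this]
    exact hr.2.trans_lt hr₁
  set φ : ℝ → ℝ := fun r => ‖f (r • ω)‖ ^ (-s) with hφ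
  have hder : ∀ r ∈ Icc r₀ r₁, HasDerivAt φ (deriv φ r) r ∧
      ‖deriv φ r‖ₑ ≤ ENNReal.ofReal s * negPowGradient n s f (r • ω) := by
    intro r hr
    obtain ⟨c, hc, hcle⟩ := exists_hasDerivAt_norm_rpow_neg hs hω (hd _ (hball r hr))
      (h0 _ (hball r hr))
    rw [hc.deriv]
    refine ⟨hc, ?_⟩
    rw [negPowGradient, indicator_of_mem (hball r hr), ← ENNReal.ofReal_mul hs.le,
      Real.enorm_eq_ofReal_abs]
    exact ENNReal.ofReal_le_ofReal hcle
  have hGm : Measurable fun r : ℝ => negPowGradient n s f (r • ω) :=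
    (measurable_negPowGradient hc).comp (by fun_prop)
  have hle : ∫⁻ r in Ioc r₀ r₁, ‖deriv φ r‖ₑ ≤ ENNReal.ofReal s * G := by
    rw [hG, ← lintegral_const_mul _ hGm]
    calc _ ≤ ∫⁻ r in Ioc r₀ r₁, ENNReal.ofReal s * negPowGradient n s f (r • ω) :=
          setLIntegral_mono' measurableSet_Ioc fun r hr => (hder r (Ioc_subset_Icc_self hr)).2
      _ ≤ _ := lintegral_mono_set (Ioc_subset_Ioo_right hr₁)
  have hint : IntervalIntegrable (deriv φ) volume r₀ r₁ := by
    rw [intervalIntegrable_iff_integrableOn_Ioc_of_le hr]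
    refine ⟨(measurable_deriv φ).aestronglyMeasurable, ?_⟩
    exact hle.trans_lt (ENNReal.mul_lt_top ENNReal.ofReal_lt_top (lt_top_iff_ne_top.2 hfin))
  have hftc := intervalIntegral.integral_eq_sub_of_hasDerivAt (f := φ) (f' := deriv φ)
    (fun r hr' => (hder r (by rwa [uIcc_of_le hr] at hr')).1) hint
  rw [intervalIntegral.integral_of_le hr] at hftc
  have h1 : ENNReal.ofReal (φ r₁ - φ r₀) ≤ ENNReal.ofReal s * G := by
    refine le_trans ?_ ((enorm_integral_le_lintegral_enorm (deriv φ)).trans hle)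
    rw [hftc, Real.enorm_eq_ofReal_abs]
    exact ENNReal.ofReal_le_ofReal (le_abs_self _)
  calc ENNReal.ofReal (φ r₁) = ENNReal.ofReal (φ r₀ + (φ r₁ - φ r₀)) := by congr 1; ring
    _ ≤ ENNReal.ofReal (φ r₀) + ENNReal.ofReal (φ r₁ - φ r₀) := ENNReal.ofReal_add_le
    _ ≤ _ := by gcongr

/-- The part of the unit ball at distance at most `4 (1 - ‖x‖)` from `x` and at distance at least
`t (1 - ‖x‖)` from the unit sphere. -/
def innerWindow (n : ℕ) (x : Vec n) (t : ℝ) : Set (Vec n) :=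
  {y | y ∈ unitBall n ∧ ‖y - x‖ ≤ 4 * (1 - ‖x‖) ∧ t * (1 - ‖x‖) ≤ 1 - ‖y‖}

theorem measurableSet_innerWindow (n : ℕ) (x : Vec n) (t : ℝ) :
    MeasurableSet (innerWindow n x t) := by
  refine (measurableSet_unitBall n).inter (IsClosed.measurableSet ?_)
  exact (isClosed_le (f := fun y : Vec n => ‖y - x‖) (g := fun _ => 4 * (1 - ‖x‖)) (by fun_prop)
    (by fun_prop)).inter (isClosed_le (f := fun _ : Vec n => t * (1 - ‖x‖))
    (g := fun y => 1 - ‖y‖) (by fun_prop) (by fun_prop))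

theorem mobiusT_mem_unitBall_of_mem_innerWindow {n : ℕ} {x y : Vec n} (hx : x ∈ unitBall n)
    {t : ℝ} (ht : 0 < t) (hy : y ∈ innerWindow n x t) : mobiusT n x y ∈ unitBall n := by
  have := one_sub_norm_mobiusT_ge hx hy.1 ht.le hy.2.1 hy.2.2
  rw [unitBall, mem_ball_zero_iff]; linarith

theorem le_norm_of_mem_innerWindow {n : ℕ} {C₀ α : ℝ} (hC₀ : 1 ≤ C₀) (hα : 0 < α)
    {f : Vec n → Vec n} (h0 : ∀ x ∈ unitBall n, f x ≠ 0) (hf : InMiniowitz n C₀ α f)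
    {x y : Vec n} (hx : x ∈ unitBall n) {t : ℝ} (ht : 0 < t) (hy : y ∈ innerWindow n x t) :
    C₀⁻¹ * (t / 144) ^ α * ‖f x‖ ≤ ‖f y‖ := by
  have hz := mobiusT_mem_unitBall_of_mem_innerWindow hx ht hy
  have hz2 := one_sub_norm_mobiusT_ge hx hy.1 ht.le hy.2.1 hy.2.2
  have h := (hf x hx _ hz).1
  rw [mobiusT_neg_mobiusT hx hy.1, mobiusT_neg_zero, le_div_iff₀ (norm_pos_iff.2 (h0 x hx))] at h
  refine le_trans ?_ h
  have hz1 : ‖mobiusT n x y‖ < 1 := by simpa [unitBall] using hz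
  have : t / 144 ≤ (1 - ‖mobiusT n x y‖) / (1 + ‖mobiusT n x y‖) := by
    rw [le_div_iff₀ (by positivity)]
    nlinarith [norm_nonneg (mobiusT n x y)]
  gcongr

theorem encard_fiber_innerWindow_le {n : ℕ} {a C₁ : ℝ} {f : Vec n → Vec n}
    (hf : MultCond n a C₁ f) {x : Vec n} (hx : x ∈ unitBall n) {t : ℝ} (ht : 0 < t) (ht1 : t ≤ 1)
    {S : Set (Vec n)} (hS : S ⊆ innerWindow n x t) (v : Vec n) :
    (({y ∈ S | f y = v}).encard : ℝ≥0∞) ≤ ENNReal.ofReal (C₁ / (t / 73) ^ a) := by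
  have h := hf x hx (1 - t / 73) (by linarith) (by linarith) v
  rw [sub_sub_cancel] at h
  refine le_trans ?_ h
  refine ENat.toENNReal_le.2 ?_
  refine encard_le_encard_of_injOn (f := mobiusT n x) ?_ ?_
  · rintro y ⟨hy, rfl⟩
    have hy' := hS hy
    have hz2 := one_sub_norm_mobiusT_ge hx hy'.1 ht.le hy'.2.1 hy'.2.2
    refine ⟨?_, by rw [mobiusT_neg_mobiusT hx hy'.1]⟩
    rw [mem_ball_zero_iff]; linarith
  · intro y hy y' hy' hyy
    rw [← mobiusT_neg_mobiusT hx (hS hy.1).1, hyy, mobiusT_neg_mobiusT hx (hS hy'.1).1]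

theorem exists_lintegral_negPowGradient_pow_le (n : ℕ) (hn : 2 ≤ n) {K C₀ α a C₁ s : ℝ}
    (hK : 1 ≤ K) (hC₀ : 1 ≤ C₀) (hα : 0 < α) (hC₁ : 0 < C₁) (hs : 0 < s) :
    ∃ C : ℝ, 0 < C ∧ ∀ f : Vec n → Vec n,
      IsQR n K f → (∀ x ∈ unitBall n, f x ≠ 0) →
      InMiniowitz n C₀ α f → MultCond n a C₁ f → ∀ x ∈ unitBall n, ∀ t : ℝ, 0 < t → t ≤ 1 →
        ∫⁻ y in innerWindow n x t, negPowGradient n s f y ^ n ≤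
          ENNReal.ofReal (C * t ^ (-(a + α * (n * s))) * ‖f x‖ ^ (-(n * s))) := by
  obtain ⟨C, hC, hCle⟩ := exists_lintegral_norm_rpow_neg_le n hn hs
  refine ⟨K * (C₁ * 73 ^ a) * (C * (C₀⁻¹ * 144⁻¹ ^ α) ^ (-(n * s))), by positivity,
    fun f hQR h0 hMin hMult x hx t ht ht1 => ?_⟩
  obtain ⟨hc, hd, hK'⟩ := hQR
  set W := innerWindow n x t
  have hWm : MeasurableSet W := measurableSet_innerWindow n x t
  set S := W ∩ {y | (fderiv ℝ f y).det ≠ 0}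
  have hSm : MeasurableSet S := by
    refine hWm.inter ?_
    have : Measurable fun y => (fderiv ℝ f y).det :=
      ContinuousLinearMap.continuous_det.measurable.comp (measurable_fderiv ℝ f)
    exact (measurableSet_eq_fun this measurable_const).compl
  set m : ℝ := C₀⁻¹ * (t / 144) ^ α * ‖f x‖ with hm
  have hfx : 0 < ‖f x‖ := norm_pos_iff.2 (h0 x hx)
  have hm0 : 0 < m := by positivity
  set φ : Vec n → ℝ≥0∞ := fun z => ENNReal.ofReal (‖z‖ ^ (-(n * (1 + s)))) with hφ
  have hφm : Measurable φ := by fun_prop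
  have hN : 0 ≤ C₁ / (t / 73) ^ a := by positivity
  have harea := lintegral_abs_det_fderiv_mul_le_of_encard_fiber_le (volume : Measure (Vec n))
    (f := f) (f' := fderiv ℝ f) hSm
    (fun y hy => (hd y hy.1.1).hasFDerivAt.hasFDerivWithinAt) (fun y hy => hy.2)
    (encard_fiber_innerWindow_le hMult hx ht ht1 inter_subset_left) hφm
    (Z := {z | m ≤ ‖z‖})
    (fun y hy => le_norm_of_mem_innerWindow hC₀ hα h0 hMin hx ht hy.1)
  calc ∫⁻ y in W, negPowGradient n s f y ^ n
      ≤ ∫⁻ y in W, ENNReal.ofReal K *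
          S.indicator (fun y => ENNReal.ofReal |(fderiv ℝ f y).det| * φ (f y)) y := by
        refine lintegral_mono_ae ?_
        have hK2 : ∀ᵐ y ∂(volume.restrict W),
            ‖fderiv ℝ f y‖ ^ n ≤ K * (fderiv ℝ f y).det :=
          ae_restrict_of_ae_restrict_of_subset (fun y hy => hy.1) hK'
        filter_upwards [hK2, ae_restrict_mem hWm] with y hy hyW
        have hfy : 0 < ‖f y‖ := norm_pos_iff.2 (h0 y hyW.1)
        rw [negPowGradient, indicator_of_mem hyW.1, ← ENNReal.ofReal_pow (by positivity), mul_pow]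
        by_cases hyS : y ∈ S
        · rw [indicator_of_mem hyS, hφ, ← ENNReal.ofReal_mul (abs_nonneg _),
            ← ENNReal.ofReal_mul (by linarith)]
          refine ENNReal.ofReal_le_ofReal ?_
          have h1 : (‖f y‖ ^ (-(1 + s))) ^ n = ‖f y‖ ^ (-(n * (1 + s))) := by
            rw [← Real.rpow_natCast, ← Real.rpow_mul hfy.le]
            congr 1; ring
          have h2 : K * (fderiv ℝ f y).det ≤ K * |(fderiv ℝ f y).det| := by
            gcongr; exact le_abs_self _
          rw [h1]
          calc _ ≤ ‖f y‖ ^ (-(n * (1 + s))) * (K * |(fderiv ℝ f y).det|) := by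
                gcongr; exact hy.trans h2
            _ = _ := by ring
        · have hdet : (fderiv ℝ f y).det = 0 := by
            by_contra h
            exact hyS ⟨hyW, h⟩
          rw [hdet, mul_zero] at hy
          have : ‖fderiv ℝ f y‖ ^ n = 0 := le_antisymm hy (by positivity)
          simp [this]
    _ = ENNReal.ofReal K * ∫⁻ y in S, ENNReal.ofReal |(fderiv ℝ f y).det| * φ (f y) := by
        rw [lintegral_const_mul' _ _ ENNReal.ofReal_ne_top, lintegral_indicator hSm,
          Measure.restrict_restrict hSm, inter_eq_left.2 inter_subset_left]
    _ ≤ ENNReal.ofReal K * (ENNReal.ofReal (C₁ / (t / 73) ^ a) *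
          ENNReal.ofReal (C * m ^ (-(n * s)))) := by
        gcongr
        exact harea.trans (by gcongr; exact hCle m hm0)
    _ = _ := by
        rw [← ENNReal.ofReal_mul hN, ← ENNReal.ofReal_mul (by linarith)]
        congr 1
        have e1 : (t / 73) ^ a = t ^ a / 73 ^ a := Real.div_rpow ht.le (by norm_num) _
        have e2 : m = (C₀⁻¹ * 144⁻¹ ^ α) * t ^ α * ‖f x‖ := by
          rw [hm, div_eq_mul_inv, Real.mul_rpow ht.le (by norm_num)]; ring
        have e3 : m ^ (-(n * s)) = (C₀⁻¹ * 144⁻¹ ^ α) ^ (-(n * s)) * t ^ (-(α * (n * s))) *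
            ‖f x‖ ^ (-(n * s)) := by
          rw [e2, Real.mul_rpow (by positivity) hfx.le, Real.mul_rpow (by positivity)
            (by positivity), ← Real.rpow_mul ht.le, mul_neg]
        have e4 : t ^ (-(a + α * (n * s))) = t ^ (-(α * (n * s))) / t ^ a := by
          rw [← Real.rpow_sub ht]; congr 1; ring
        rw [e1, e3, e4]
        field_simp

theorem lintegral_lintegral_le_rpow_mul_rpow {X Y : Type*} [MeasurableSpace X] [MeasurableSpace Y]
    (μ : Measure X) (ν : Measure Y) [SFinite μ] [SFinite ν] {n : ℕ} (hn : 2 ≤ n)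
    {F : X × Y → ℝ≥0∞} (hF : Measurable F) :
    ∫⁻ x, ∫⁻ y, F (x, y) ∂ν ∂μ ≤
      (∫⁻ x, ∫⁻ y, F (x, y) ^ n ∂ν ∂μ) ^ (1 / (n : ℝ)) *
        (μ univ * ν univ) ^ (1 - 1 / (n : ℝ)) := by
  have hn' : (2 : ℝ) ≤ n := by exact_mod_cast hn
  have hpq : (n : ℝ).HolderConjugate (1 - 1 / (n : ℝ))⁻¹ := by
    rw [Real.holderConjugate_iff]
    refine ⟨by linarith, ?_⟩
    rw [inv_inv]; ring
  have h := ENNReal.lintegral_mul_le_Lp_mul_Lq (μ.prod ν) hpq hF.aemeasurable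
    (aemeasurable_const (b := (1 : ℝ≥0∞)))
  simp only [Pi.mul_apply, mul_one, ENNReal.one_rpow, lintegral_const, one_mul,
    ENNReal.rpow_natCast, one_div, inv_inv] at h
  rw [lintegral_prod _ hF.aemeasurable, lintegral_prod _ (hF.pow_const n).aemeasurable,
    ← univ_prod_univ, Measure.prod_prod] at h
  simpa only [one_div] using h

theorem exists_setLIntegral_radial_negPowGradient_le (n : ℕ) (hn : 2 ≤ n) {K C₀ α a C₁ s : ℝ}
    (hK : 1 ≤ K) (hC₀ : 1 ≤ C₀) (hα : 0 < α) (hC₁ : 0 < C₁) (hs : 0 < s)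
    (hβ : a + α * (n * s) < n - 1) :
    ∃ M : ℝ, 0 < M ∧ ∀ f : Vec n → Vec n,
      IsQR n K f → (∀ x ∈ unitBall n, f x ≠ 0) →
      InMiniowitz n C₀ α f → MultCond n a C₁ f → ∀ x ∈ unitBall n,
      ∀ E : Set (sphere (0 : Vec n) 1), MeasurableSet E →
        (∀ ω ∈ E, ‖(ω : Vec n) - x‖ ≤ 3 * (1 - ‖x‖)) →
        ∫⁻ ω in E, (∫⁻ r in Ioo (1 - (1 - ‖x‖) / 2) 1, negPowGradient n s f (r • (ω : Vec n)))
            ∂coneMeasure n ≤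
          ENNReal.ofReal (M * (1 - ‖x‖) ^ (n - 1) * ‖f x‖ ^ (-s)) := by
  have hn' : (2 : ℝ) ≤ n := by exact_mod_cast hn
  obtain ⟨A, hA, hAle⟩ := exists_lintegral_negPowGradient_pow_le n hn hK hC₀ hα (a := a) hC₁ hs
  obtain ⟨B, hB, hBle⟩ := exists_coneMeasure_le n hn
  set β := a + α * (n * s) with hβdef
  set γ : ℝ := (n - 1 - β) / n with hγ
  have hγ0 : 0 < γ := div_pos (by linarith) (by linarith)
  set q : ℝ := (1 / 2) ^ γ with hq
  have hq0 : 0 < q := by positivity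
  have hq1 : q < 1 := Real.rpow_lt_one (by norm_num) (by norm_num) hγ0
  set D : ℝ := (2 ^ (n - 1) * A) ^ (1 / (n : ℝ)) * (B * 3 ^ (n - 1)) ^ (1 - 1 / (n : ℝ)) with hD
  refine ⟨D * (q ^ 2 * (1 - q)⁻¹), by have := sub_pos.2 hq1; positivity,
    fun f hQR h0 hMin hMult x hx E hE hEx => ?_⟩
  set h : ℝ := 1 - ‖x‖ with hh
  have hx1 : ‖x‖ < 1 := by simpa [unitBall] using hx
  have hh0 : 0 < h := by linarith
  have hh1 : h ≤ 1 := by linarith [norm_nonneg x]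
  have hfx : 0 < ‖f x‖ := norm_pos_iff.2 (h0 x hx)
  have hGm := measurable_negPowGradient (n := n) (s := s) hQR.1
  set G := negPowGradient n s f
  have hGm2 : Measurable fun z : sphere (0 : Vec n) 1 × ℝ => G (z.2 • (z.1 : Vec n)) :=
    hGm.comp (by fun_prop)
  set I : ℕ → Set ℝ := fun k => Icc (1 - (1 / 2) ^ (k + 1) * h) (1 - (1 / 2) ^ (k + 2) * h)
    with hI
  have hcover : Ioo (1 - h / 2) 1 ⊆ ⋃ k, I k := by
    intro r hr
    obtain ⟨k, hk1, hk2⟩ := exists_nat_pow_near_of_lt_one (x := 2 * ((1 - r) / h))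
      (y := (1 / 2 : ℝ)) (by have := hr.2; have : 0 < 1 - r := by linarith
                             positivity)
      (by rw [mul_div_assoc', div_le_one hh0]; linarith [hr.1]) (by norm_num) (by norm_num)
    rw [mul_div_assoc', lt_div_iff₀ hh0] at hk1
    rw [mul_div_assoc', div_le_iff₀ hh0] at hk2
    rw [mem_iUnion]
    refine ⟨k, ?_, ?_⟩
    · rw [pow_succ]; linarith
    · rw [pow_succ]; linarith
  have hpiece : ∀ k, ∫⁻ ω in E, (∫⁻ r in I k, G (r • (ω : Vec n))) ∂coneMeasure n ≤
      ENNReal.ofReal (D * h ^ (n - 1) * ‖f x‖ ^ (-s) * q ^ 2 * q ^ k) := by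
    intro k
    set t : ℝ := (1 / 2) ^ (k + 2) with ht
    have ht0 : 0 < t := by positivity
    have ht1 : t ≤ 1 / 4 := by
      rw [ht, pow_add]
      have : (1 / 2 : ℝ) ^ k ≤ 1 := pow_le_one₀ (by norm_num) (by norm_num)
      norm_num at this ⊢
      linarith
    have hIk : I k = Icc (1 - 2 * t * h) (1 - t * h) := by
      rw [hI, ht]
      have : (1 / 2 : ℝ) ^ (k + 1) = 2 * (1 / 2) ^ (k + 2) := by ring
      simp only [this]
    have hth : t * h ≤ 1 / 4 := by nlinarith
    have hW : ∀ ω ∈ E, ∀ r ∈ I k, r • (ω : Vec n) ∈ innerWindow n x t := by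
      intro ω hω r hr
      rw [hIk] at hr
      have hω1 : ‖(ω : Vec n)‖ = 1 := by simp
      have hr0 : 0 ≤ r := by linarith [hr.1]
      have hr1 : ‖r • (ω : Vec n)‖ = r := by rw [norm_smul, hω1, mul_one, Real.norm_of_nonneg hr0]
      have hth0 : 0 < t * h := by positivity
      refine ⟨?_, ?_, ?_⟩
      · rw [unitBall, mem_ball_zero_iff, hr1]; linarith [hr.2]
      · have e : r • (ω : Vec n) - x = (ω - x) - (1 - r) • (ω : Vec n) := by module
        have e2 : ‖(1 - r) • (ω : Vec n)‖ = 1 - r := by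
          rw [norm_smul, hω1, mul_one, Real.norm_of_nonneg (by linarith [hr.2])]
        rw [e]
        have := norm_sub_le ((ω : Vec n) - x) ((1 - r) • (ω : Vec n))
        have h3 := hEx ω hω
        have h4 : t * h ≤ 1 / 4 * h := by gcongr
        rw [← hh]
        linarith [hr.1]
      · rw [hr1]; linarith [hr.2]
    have h1 : ∫⁻ ω in E, (∫⁻ r in I k, G (r • (ω : Vec n)) ^ n) ∂coneMeasure n ≤
        ENNReal.ofReal (2 ^ (n - 1) * (A * t ^ (-β) * ‖f x‖ ^ (-(n * s)))) := by
      refine (setLIntegral_sector_le hn (φ := fun y => G y ^ n) (hGm.pow_const n) hE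
        measurableSet_Icc ?_ (measurableSet_innerWindow n x t) hW).trans ?_
      · change I k ⊆ _
        rw [hIk]
        exact Icc_subset_Icc (by linarith) (by linarith [mul_pos ht0 hh0])
      · rw [ENNReal.ofReal_mul (by positivity)]
        gcongr
        exact hAle f hQR h0 hMin hMult x hx t ht0 (by linarith)
    have h2 : coneMeasure n E * volume (I k) ≤
        ENNReal.ofReal (B * (3 * h) ^ (n - 1) * (t * h)) := by
      rw [ENNReal.ofReal_mul (by positivity)]
      gcongr
      · exact hBle x (3 * h) (by positivity) E hEx
      · rw [hIk, Real.volume_Icc]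
        exact ENNReal.ofReal_le_ofReal (by linarith)
    have hHolder := lintegral_lintegral_le_rpow_mul_rpow ((coneMeasure n).restrict E)
      (volume.restrict (I k)) hn hGm2
    simp only [Measure.restrict_apply_univ] at hHolder
    have hexp : 0 ≤ 1 - 1 / (n : ℝ) := by
      rw [sub_nonneg, div_le_one (by linarith)]; linarith
    refine hHolder.trans ((mul_le_mul' (ENNReal.rpow_le_rpow h1 (by positivity))
      (ENNReal.rpow_le_rpow h2 hexp)).trans (le_of_eq ?_))
    rw [ENNReal.ofReal_rpow_of_nonneg (by positivity) (by positivity),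
      ENNReal.ofReal_rpow_of_nonneg (by positivity) hexp,
      ← ENNReal.ofReal_mul (by positivity)]
    congr 1
    have hn0 : (n : ℝ) ≠ 0 := by linarith
    have e1 : (2 ^ (n - 1) * (A * t ^ (-β) * ‖f x‖ ^ (-(n * s)))) ^ (1 / (n : ℝ)) =
        (2 ^ (n - 1) * A) ^ (1 / (n : ℝ)) * t ^ (-β / n) * ‖f x‖ ^ (-s) := by
      rw [← mul_assoc, ← mul_assoc, Real.mul_rpow (by positivity) (by positivity),
        Real.mul_rpow (by positivity) (by positivity), ← Real.rpow_mul ht0.le,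
        ← Real.rpow_mul hfx.le]
      congr 2
      · congr 1; ring
      · field_simp
    have e2 : (B * (3 * h) ^ (n - 1) * (t * h)) ^ (1 - 1 / (n : ℝ)) =
        (B * 3 ^ (n - 1)) ^ (1 - 1 / (n : ℝ)) * h ^ (n - 1) * t ^ (1 - 1 / (n : ℝ)) := by
      have : B * (3 * h) ^ (n - 1) * (t * h) = (B * 3 ^ (n - 1)) * h ^ (n : ℝ) * t := by
        rw [Real.rpow_natCast, mul_pow]
        have : h ^ n = h ^ (n - 1) * h := by rw [← pow_succ]; congr 1; omega
        rw [this]; ring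
      rw [this, Real.mul_rpow (by positivity) ht0.le, Real.mul_rpow (by positivity) (by positivity),
        ← Real.rpow_mul hh0.le]
      congr 2
      rw [← Real.rpow_natCast, Nat.cast_sub (by omega)]
      congr 1
      field_simp
      norm_num
    have e3 : t ^ (-β / n) * t ^ (1 - 1 / (n : ℝ)) = q ^ 2 * q ^ k := by
      rw [← Real.rpow_add ht0, ← pow_add, hq, ht, ← Real.rpow_natCast, ← Real.rpow_natCast,
        ← Real.rpow_mul (by norm_num), ← Real.rpow_mul (by norm_num)]
      congr 1
      rw [hγ]; push_cast; field_simp; ring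
    rw [e1, e2, hD]
    linear_combination ((2 ^ (n - 1) * A) ^ (1 / (n : ℝ)) * ‖f x‖ ^ (-s) *
      ((B * 3 ^ (n - 1)) ^ (1 - 1 / (n : ℝ)) * h ^ (n - 1))) * e3
  have hsum := (hasSum_geometric_of_lt_one hq0.le hq1).mul_left
    (D * h ^ (n - 1) * ‖f x‖ ^ (-s) * q ^ 2)
  calc _ ≤ ∫⁻ ω in E, (∑' k, ∫⁻ r in I k, G (r • (ω : Vec n))) ∂coneMeasure n :=
        lintegral_mono fun ω => (lintegral_mono_set hcover).trans (lintegral_iUnion_le _ _)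
    _ = ∑' k, ∫⁻ ω in E, (∫⁻ r in I k, G (r • (ω : Vec n))) ∂coneMeasure n :=
        lintegral_tsum fun k => hGm2.lintegral_prod_right'.aemeasurable
    _ ≤ ∑' k, ENNReal.ofReal (D * h ^ (n - 1) * ‖f x‖ ^ (-s) * q ^ 2 * q ^ k) :=
        ENNReal.tsum_le_tsum hpiece
    _ = _ := by
        rw [← ENNReal.ofReal_tsum_of_nonneg (fun k => by positivity) hsum.summable, hsum.tsum_eq]
        congr 1; ring

theorem tendsto_smul_nhdsWithin_ntRegion {n : ℕ} {κ : ℝ} (hκ : 0 < κ) {ω : Vec n} (hω : ‖ω‖ = 1) :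
    Tendsto (fun r : ℝ => r • ω) (𝓝[<] 1) (𝓝[ntRegion n κ ω] ω) := by
  refine tendsto_nhdsWithin_iff.2 ⟨?_, ?_⟩
  · have : Continuous fun r : ℝ => r • ω := by fun_prop
    simpa using (this.tendsto 1).mono_left nhdsWithin_le_nhds
  · filter_upwards [Ioo_mem_nhdsLT (zero_lt_one (α := ℝ))] with r hr
    have hr1 : ‖r • ω‖ = r := by rw [norm_smul, hω, mul_one, Real.norm_of_nonneg hr.1.le]
    refine ⟨?_, ?_⟩
    · rw [unitBall, mem_ball_zero_iff, hr1]; exact hr.2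
    · have e : r • ω - ω = (r - 1) • ω := by module
      rw [hr1, e, norm_smul, hω, mul_one, Real.norm_eq_abs, abs_sub_comm,
        abs_of_pos (by linarith [hr.2])]
      nlinarith [hr.2]

theorem aemeasurable_of_hasNTLimit {n : ℕ} {κ : ℝ} (hκ : 0 < κ) {f g : Vec n → Vec n}
    (hf : ContinuousOn f (unitBall n))
    (hg : ∀ᵐ ω : sphere (0 : Vec n) 1 ∂coneMeasure n, HasNTLimit n κ f ω (g ω)) :
    AEMeasurable (fun ω : sphere (0 : Vec n) 1 => g ω) (coneMeasure n) := by
  have hu : Tendsto (fun k : ℕ => 1 - 1 / ((k : ℝ) + 1)) atTop (𝓝[<] 1) := by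
    refine tendsto_nhdsWithin_iff.2 ⟨?_, Eventually.of_forall fun k => ?_⟩
    · simpa using tendsto_one_div_add_atTop_nhds_zero_nat (𝕜 := ℝ) |>.const_sub 1
    · have : (0 : ℝ) < 1 / ((k : ℝ) + 1) := by positivity
      simpa using this
  refine aemeasurable_of_tendsto_metrizable_ae atTop
    (f := fun (k : ℕ) (ω : sphere (0 : Vec n) 1) =>
      (unitBall n).indicator f ((1 - 1 / ((k : ℝ) + 1)) • (ω : Vec n))) (fun k => ?_) ?_
  · exact ((measurable_indicator_unitBall hf).comp (by fun_prop)).aemeasurable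
  · filter_upwards [hg] with ω hω
    have h1 : Tendsto ((unitBall n).indicator f) (𝓝[ntRegion n κ ω] (ω : Vec n)) (𝓝 (g ω)) := by
      refine hω.congr' ?_
      filter_upwards [self_mem_nhdsWithin] with y hy
      rw [indicator_of_mem hy.1]
    exact (h1.comp (tendsto_smul_nhdsWithin_ntRegion hκ (by simp))).comp hu

theorem exists_ofReal_norm_rpow_mul_le_setLIntegral (n : ℕ) (hn : 2 ≤ n)
    {K C₀ α a C₁ κ p b : ℝ} (hK : 1 ≤ K) (hC₀ : 1 ≤ C₀) (hα : 0 < α) (ha : a < (n : ℝ) - 1)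
    (hC₁ : 0 < C₁) (hκ : 0 < κ) (hp : 0 < p) (hb : 0 < b) :
    ∃ C : ℝ, 0 < C ∧ ∀ f : Vec n → Vec n,
      IsQR n K f → (∀ x ∈ unitBall n, f x ≠ 0) →
      InMiniowitz n C₀ α f → MultCond n a C₁ f →
      ∀ g : Vec n → Vec n,
        (∀ᵐ ω : sphere (0 : Vec n) 1 ∂coneMeasure n, HasNTLimit n κ f ω (g ω)) →
        ∀ x ∈ unitBall n, ∀ E : Set (sphere (0 : Vec n) 1), MeasurableSet E →
          (∀ ω ∈ E, ‖(ω : Vec n) - x‖ ≤ 3 * (1 - ‖x‖)) →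
          ENNReal.ofReal (b * (1 - ‖x‖) ^ (n - 1)) ≤ coneMeasure n E →
          ENNReal.ofReal (‖f x‖ ^ p * (1 - ‖x‖) ^ (n - 1)) ≤
            ENNReal.ofReal C * ∫⁻ ω in E, ENNReal.ofReal (‖g ω‖ ^ p) ∂coneMeasure n := by
  have hn' : (2 : ℝ) ≤ n := by exact_mod_cast hn
  obtain ⟨s, hs, hβ⟩ : ∃ s : ℝ, 0 < s ∧ a + α * (n * s) < n - 1 := by
    refine ⟨(n - 1 - a) / (2 * α * n), div_pos (by linarith) (by positivity), ?_⟩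
    have : α * (n * ((n - 1 - a) / (2 * α * n))) = (n - 1 - a) / 2 := by
      have : (n : ℝ) ≠ 0 := by linarith
      field_simp
    linarith
  obtain ⟨M, hM, hMle⟩ :=
    exists_setLIntegral_radial_negPowGradient_le n hn hK hC₀ hα hC₁ hs hβ
  set c : ℝ := C₀⁻¹ * (1 / 2 / 144) ^ α with hc
  have hc0 : 0 < c := by positivity
  set Q : ℝ := c ^ (-s) + s * (2 * M / b) with hQ
  have hQ0 : 0 < Q := by positivity
  set c' : ℝ := Q ^ (-1 / s) with hc'
  have hc'0 : 0 < c' := by positivity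
  refine ⟨2 / (c' ^ p * b), by positivity, fun f hQR h0 hMin hMult g hg x hx E hE hEx hEb => ?_⟩
  have hx1 : ‖x‖ < 1 := by simpa [unitBall] using hx
  set h : ℝ := 1 - ‖x‖ with hh
  have hh0 : 0 < h := by linarith
  have hh1 : h ≤ 1 := by linarith [norm_nonneg x]
  have hfx : 0 < ‖f x‖ := norm_pos_iff.2 (h0 x hx)
  have hGm := measurable_negPowGradient (n := n) (s := s) hQR.1
  have hGm2 : Measurable fun z : sphere (0 : Vec n) 1 × ℝ =>
      negPowGradient n s f (z.2 • (z.1 : Vec n)) := hGm.comp (by fun_prop)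
  set F : sphere (0 : Vec n) 1 → ℝ≥0∞ := fun ω =>
    ∫⁻ r in Ioo (1 - h / 2) 1, negPowGradient n s f (r • (ω : Vec n)) with hF
  have hFm : Measurable F := hGm2.lintegral_prod_right'
  have hFle := hMle f hQR h0 hMin hMult x hx E hE hEx
  set lam : ℝ := 2 * M / b * ‖f x‖ ^ (-s) with hlam
  have hlam0 : 0 < lam := by positivity
  set good : Set (sphere (0 : Vec n) 1) := E ∩ {ω | F ω < ENNReal.ofReal lam} with hgood
  set bad : Set (sphere (0 : Vec n) 1) := {ω | ENNReal.ofReal lam ≤ F ω} ∩ E with hbad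
  have hgoodm : MeasurableSet good := hE.inter (measurableSet_lt hFm measurable_const)
  have hbad_le : coneMeasure n bad ≤ ENNReal.ofReal (b * h ^ (n - 1) / 2) := by
    have h1 := mul_meas_ge_le_lintegral (μ := (coneMeasure n).restrict E) hFm (ENNReal.ofReal lam)
    rw [Measure.restrict_apply' hE] at h1
    have h2 : ENNReal.ofReal lam * coneMeasure n bad ≤
        ENNReal.ofReal lam * ENNReal.ofReal (b * h ^ (n - 1) / 2) := by
      refine (h1.trans hFle).trans (le_of_eq ?_)
      rw [← ENNReal.ofReal_mul hlam0.le]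
      congr 1
      rw [hlam, ← hh]; field_simp
    exact (ENNReal.mul_le_mul_iff_right (by simpa using hlam0) ENNReal.ofReal_ne_top).1 h2
  have hgood_ge : ENNReal.ofReal (b * h ^ (n - 1) / 2) ≤ coneMeasure n good := by
    have h1 : coneMeasure n E ≤ coneMeasure n good + coneMeasure n bad := by
      refine (measure_mono fun ω hω => ?_).trans (measure_union_le _ _)
      rcases lt_or_ge (F ω) (ENNReal.ofReal lam) with h | h
      · exact Or.inl ⟨hω, h⟩
      · exact Or.inr ⟨h, hω⟩
    have h2 : ENNReal.ofReal (b * h ^ (n - 1)) = ENNReal.ofReal (b * h ^ (n - 1) / 2) +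
        ENNReal.ofReal (b * h ^ (n - 1) / 2) := by
      rw [← ENNReal.ofReal_add (by positivity) (by positivity), add_halves]
    have h3 := (h2.symm.le.trans hEb).trans (h1.trans (add_le_add_right hbad_le _))
    exact (ENNReal.add_le_add_iff_right ENNReal.ofReal_ne_top).1 h3
  have hpoint : ∀ᵐ ω : sphere (0 : Vec n) 1 ∂coneMeasure n, ω ∈ good →
      ENNReal.ofReal ((c' * ‖f x‖) ^ p) ≤ ENNReal.ofReal (‖g ω‖ ^ p) := by
    filter_upwards [hg] with ω hω hωgood
    have hω1 : ‖(ω : Vec n)‖ = 1 := by simp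
    suffices hlim : c' * ‖f x‖ ≤ ‖g ω‖ by gcongr
    have hlim : Tendsto (fun r : ℝ => ‖f (r • (ω : Vec n))‖) (𝓝[<] 1) (𝓝 ‖g ω‖) :=
      (hω.comp (tendsto_smul_nhdsWithin_ntRegion hκ hω1)).norm
    refine ge_of_tendsto hlim ?_
    have hr₀ : 0 ≤ 1 - h / 2 := by linarith
    have hnr₀ : ‖(1 - h / 2) • (ω : Vec n)‖ = 1 - h / 2 := by
      rw [norm_smul, hω1, mul_one, Real.norm_of_nonneg hr₀]
    have hwin : (1 - h / 2) • (ω : Vec n) ∈ innerWindow n x (1 / 2) := by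
      refine ⟨?_, ?_, ?_⟩
      · rw [unitBall, mem_ball_zero_iff, hnr₀]; linarith
      · have e : (1 - h / 2) • (ω : Vec n) - x = (ω - x) - (h / 2) • (ω : Vec n) := by module
        have e2 : ‖(h / 2) • (ω : Vec n)‖ = h / 2 := by
          rw [norm_smul, hω1, mul_one, Real.norm_of_nonneg (by linarith)]
        rw [e]
        have := norm_sub_le ((ω : Vec n) - x) ((h / 2) • (ω : Vec n))
        have := hEx ω hωgood.1
        linarith
      · rw [hnr₀]; linarith
    have hlow := le_norm_of_mem_innerWindow hC₀ hα h0 hMin hx (by norm_num) hwin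
    filter_upwards [Ioo_mem_nhdsLT (show 1 - h / 2 < 1 by linarith)] with r hr
    have hrball : r • (ω : Vec n) ∈ unitBall n := by
      rw [unitBall, mem_ball_zero_iff, norm_smul, hω1, mul_one,
        Real.norm_of_nonneg (hr₀.trans hr.1.le)]
      exact hr.2
    have hfr : 0 < ‖f (r • (ω : Vec n))‖ := norm_pos_iff.2 (h0 _ hrball)
    have h1 := norm_rpow_neg_le_add_lintegral hs hQR.1 hQR.2.1 h0 hω1 hr₀ hr.1.le hr.2
    have h2 : ENNReal.ofReal (‖f (r • (ω : Vec n))‖ ^ (-s)) ≤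
        ENNReal.ofReal (Q * ‖f x‖ ^ (-s)) := by
      refine h1.trans ?_
      have e : Q * ‖f x‖ ^ (-s) = (c * ‖f x‖) ^ (-s) + s * lam := by
        rw [hQ, hlam, Real.mul_rpow hc0.le hfx.le]; ring
      rw [e, ENNReal.ofReal_add (by positivity) (by positivity), ENNReal.ofReal_mul hs.le]
      refine add_le_add (ENNReal.ofReal_le_ofReal ?_) (mul_le_mul_right hωgood.2.le _)
      exact Real.rpow_le_rpow_of_nonpos (by positivity) hlow (by linarith)
    rw [ENNReal.ofReal_le_ofReal_iff (by positivity)] at h2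
    have h3 : (c' * ‖f x‖) ^ (-s) = Q * ‖f x‖ ^ (-s) := by
      rw [Real.mul_rpow hc'0.le hfx.le, hc', ← Real.rpow_mul hQ0.le]
      have : -1 / s * -s = 1 := by field_simp
      rw [this, Real.rpow_one]
    rw [← h3] at h2
    exact (Real.rpow_le_rpow_iff_of_neg hfr (by positivity) (by linarith)).1 h2
  calc ENNReal.ofReal (‖f x‖ ^ p * h ^ (n - 1))
      = ENNReal.ofReal (2 / (c' ^ p * b)) * (ENNReal.ofReal ((c' * ‖f x‖) ^ p) *
          ENNReal.ofReal (b * h ^ (n - 1) / 2)) := by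
        rw [← ENNReal.ofReal_mul (by positivity), ← ENNReal.ofReal_mul (by positivity),
          Real.mul_rpow hc'0.le hfx.le]
        congr 1
        field_simp
    _ ≤ ENNReal.ofReal (2 / (c' ^ p * b)) *
          ∫⁻ ω in good, ENNReal.ofReal (‖g ω‖ ^ p) ∂coneMeasure n := by
        gcongr
        refine le_trans ?_ (setLIntegral_mono_ae' hgoodm hpoint)
        rw [setLIntegral_const]
        gcongr
    _ ≤ _ := by
        gcongr
        exact inter_subset_left

theorem exists_norm_eq_one_mem_orthogonal {n : ℕ} (hn : 2 ≤ n) {L : Submodule ℝ (Vec n)}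
    (hL : Module.finrank ℝ L = n - 1) : ∃ e : Vec n, ‖e‖ = 1 ∧ ∀ x ∈ L, inner ℝ e x = 0 := by
  have h := L.finrank_add_finrank_orthogonal
  rw [hL, finrank_euclideanSpace_fin] at h
  have hne : Lᗮ ≠ ⊥ := by
    intro hbot
    rw [hbot, finrank_bot] at h
    omega
  obtain ⟨v, hv, hv0⟩ := Submodule.exists_mem_ne_zero_of_ne_bot hne
  refine ⟨‖v‖⁻¹ • v, ?_, fun x hx => ?_⟩
  · rw [norm_smul, norm_inv, norm_norm, inv_mul_cancel₀ (norm_ne_zero_iff.2 hv0)]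
  · rw [inner_smul_left, (L.mem_orthogonal' v).1 hv x hx, mul_zero]

/-- The points of the sphere seen from `x` at a scale comparable to `1 - ‖x‖` and staying away from
the hyperplane orthogonal to `e`. -/
def transversalCap (n : ℕ) (e x : Vec n) : Set (sphere (0 : Vec n) 1) :=
  {ω | ‖(ω : Vec n) - x‖ < 3 * (1 - ‖x‖) ∧ 1 - ‖x‖ < 2 * |inner ℝ e (ω : Vec n)|}

theorem measurableSet_setOf_mem_transversalCap (n : ℕ) (e : Vec n) :
    MeasurableSet {z : Vec n × sphere (0 : Vec n) 1 | z.2 ∈ transversalCap n e z.1} :=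
  ((isOpen_lt (f := fun z : Vec n × sphere (0 : Vec n) 1 => ‖(z.2 : Vec n) - z.1‖)
      (g := fun z => 3 * (1 - ‖z.1‖)) (by fun_prop) (by fun_prop)).inter
    (isOpen_lt (f := fun z : Vec n × sphere (0 : Vec n) 1 => 1 - ‖z.1‖)
      (g := fun z => 2 * |inner ℝ e (z.2 : Vec n)|) (by fun_prop) (by fun_prop))).measurableSet

theorem exists_le_coneMeasure_transversalCap (n : ℕ) (hn : 2 ≤ n) :
    ∃ b : ℝ, 0 < b ∧ ∀ e x : Vec n, ‖e‖ = 1 → inner ℝ e x = 0 → x ∈ unitBall n →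
      ENNReal.ofReal (b * (1 - ‖x‖) ^ (n - 1)) ≤ coneMeasure n (transversalCap n e x) := by
  obtain ⟨C, hC, hCle⟩ := exists_le_coneMeasure n hn
  refine ⟨C * (1 / 2) ^ (n - 1), by positivity, fun e x he hex hx => ?_⟩
  have hx1 : ‖x‖ < 1 := by simpa [unitBall] using hx
  set h : ℝ := 1 - ‖x‖ with hh
  have hh0 : 0 < h := by linarith
  have hh1 : h ≤ 1 := by linarith [norm_nonneg x]
  have hnhe : ‖h • e‖ = h := by rw [norm_smul, he, mul_one, Real.norm_of_nonneg hh0.le]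
  set v : Vec n := x + h • e with hv
  have hv_sq : ‖v‖ ^ 2 = ‖x‖ ^ 2 + h ^ 2 := by
    rw [hv, norm_add_sq_real, hnhe, inner_smul_right, real_inner_comm, hex]; ring
  have hv0 : 0 < ‖v‖ := by
    have : 0 < ‖v‖ ^ 2 := by rw [hv_sq]; positivity
    exact lt_of_pow_lt_pow_left₀ 2 (norm_nonneg _) (by simpa using this)
  have hv1 : ‖v‖ ≤ 1 := by
    have := norm_add_le x (h • e)
    rw [hnhe] at this
    linarith
  have hvx : ‖x‖ ≤ ‖v‖ := by
    refine (pow_le_pow_iff_left₀ (norm_nonneg _) (norm_nonneg _) two_ne_zero).1 ?_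
    rw [hv_sq]; linarith [sq_nonneg h]
  set ω₀ : Vec n := ‖v‖⁻¹ • v with hω₀
  have hω₀1 : ‖ω₀‖ = 1 := by
    rw [hω₀, norm_smul, norm_inv, norm_norm, inv_mul_cancel₀ hv0.ne']
  have hω₀v : ‖ω₀ - v‖ = 1 - ‖v‖ := by
    have : ω₀ - v = (1 - ‖v‖) • ω₀ := by
      rw [sub_smul, one_smul, hω₀, smul_inv_smul₀ hv0.ne']
    rw [this, norm_smul, hω₀1, mul_one, Real.norm_of_nonneg (by linarith)]
  have hω₀x : ‖ω₀ - x‖ ≤ 2 * h := by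
    have e1 : ω₀ - x = (ω₀ - v) + h • e := by rw [hv]; abel
    rw [e1]
    have := norm_add_le (ω₀ - v) (h • e)
    rw [hω₀v, hnhe] at this
    linarith
  have hω₀e : h ≤ inner ℝ e ω₀ := by
    rw [hω₀, hv, inner_smul_right, inner_add_right, hex, inner_smul_right, ← hv,
      real_inner_self_eq_norm_sq, he, zero_add, one_pow, mul_one, inv_mul_eq_div,
      le_div_iff₀ hv0]
    nlinarith
  have hcap := hCle ⟨ω₀, by simpa using hω₀1⟩ (h / 2) (by linarith) (by linarith)
  have e1 : C * (h / 2) ^ (n - 1) = C * (1 / 2) ^ (n - 1) * h ^ (n - 1) := by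
    rw [mul_assoc, ← mul_pow]; congr 2; ring
  rw [e1] at hcap
  refine hcap.trans (measure_mono fun ω hω => ?_)
  replace hω : ‖(ω : Vec n) - ω₀‖ < h / 2 := hω
  refine ⟨?_, ?_⟩
  · have := norm_sub_le_norm_sub_add_norm_sub (ω : Vec n) ω₀ x
    linarith
  · have h1 : |inner ℝ e ((ω : Vec n) - ω₀)| ≤ ‖(ω : Vec n) - ω₀‖ := by
      simpa [he] using abs_real_inner_le_norm e ((ω : Vec n) - ω₀)
    rw [inner_sub_right] at h1
    have h2 := (abs_le.1 h1).1
    have h3 := le_abs_self (inner ℝ e (ω : Vec n))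
    linarith

theorem exists_setLIntegral_transversalCap_le (n : ℕ) (hn : 2 ≤ n) :
    ∃ C : ℝ, 0 < C ∧ ∀ L : Submodule ℝ (Vec n), Module.finrank ℝ L = n - 1 → ∀ e : Vec n,
      ‖e‖ = 1 → (∀ x ∈ L, inner ℝ e x = 0) → ∀ ω : sphere (0 : Vec n) 1,
      ∫⁻ x in (L : Set (Vec n)) ∩ unitBall n, (transversalCap n e x).indicator
        (fun _ => ENNReal.ofReal (((1 - ‖x‖) ^ (n - 1))⁻¹)) ω ∂(μH[(n : ℝ) - 1]) ≤
          ENNReal.ofReal C := by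
  obtain ⟨A, hA, hAle⟩ := exists_hausdorffMeasure_hyperplane_le n hn
  refine ⟨18 ^ (n - 1) * A, by positivity, fun L hL e he hLe ω => ?_⟩
  have hLm : MeasurableSet (L : Set (Vec n)) := L.closed_of_finiteDimensional.measurableSet
  set d : ℝ := |inner ℝ e (ω : Vec n)| with hd
  rcases (show 0 ≤ d from abs_nonneg _).eq_or_lt with hd0 | hd0
  · rw [setLIntegral_congr_fun (hLm.inter (measurableSet_unitBall n)) (g := fun _ => 0)]
    · simp
    · intro x hx
      have hx1 : ‖x‖ < 1 := by simpa [unitBall] using hx.2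
      refine indicator_of_notMem (fun hω => ?_) _
      have := hω.2
      linarith
  · set S : Set (Vec n) := (L : Set (Vec n)) ∩ ball (ω : Vec n) (6 * d) with hS
    have hSm : MeasurableSet S := hLm.inter measurableSet_ball
    calc _ ≤ ∫⁻ x in (L : Set (Vec n)) ∩ unitBall n,
          S.indicator (fun _ => ENNReal.ofReal (((d / 3) ^ (n - 1))⁻¹)) x ∂(μH[(n : ℝ) - 1]) := by
          refine setLIntegral_mono' (hLm.inter (measurableSet_unitBall n)) fun x hx => ?_
          by_cases hω : ω ∈ transversalCap n e x
          · have hd3 : d < 3 * (1 - ‖x‖) := by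
              refine lt_of_le_of_lt ?_ hω.1
              have := abs_real_inner_le_norm e ((ω : Vec n) - x)
              rwa [he, one_mul, inner_sub_right, hLe x hx.1, sub_zero] at this
            have hxS : x ∈ S := by
              refine ⟨hx.1, ?_⟩
              rw [mem_ball, dist_comm, dist_eq_norm]
              linarith [hω.1, hω.2]
            rw [indicator_of_mem hω, indicator_of_mem hxS]
            have : d / 3 ≤ 1 - ‖x‖ := by linarith
            gcongr
          · rw [indicator_of_notMem hω]; exact zero_le
      _ ≤ ∫⁻ x, S.indicator (fun _ => ENNReal.ofReal (((d / 3) ^ (n - 1))⁻¹)) x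
            ∂(μH[(n : ℝ) - 1]) := setLIntegral_le_lintegral _ _
      _ = ENNReal.ofReal (((d / 3) ^ (n - 1))⁻¹) * μH[(n : ℝ) - 1] S :=
          lintegral_indicator_const hSm _
      _ ≤ ENNReal.ofReal (((d / 3) ^ (n - 1))⁻¹) * ENNReal.ofReal (A * (6 * d) ^ (n - 1)) := by
          gcongr
          exact hAle L hL _ _ (by positivity)
      _ = _ := by
          rw [← ENNReal.ofReal_mul (by positivity)]
          congr 1
          have : 6 * d = 18 * (d / 3) := by ring
          have hd3 : (d / 3) ^ (n - 1) ≠ 0 := by positivity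
          rw [this, mul_pow]
          set u := (d / 3) ^ (n - 1)
          field_simp

theorem hyperplane_estimate (n : ℕ) (hn : 2 ≤ n) (K C₀ α a C₁ κ p : ℝ)
    (hK : 1 ≤ K) (hC₀ : 1 ≤ C₀) (hα : 0 < α) (ha0 : 0 ≤ a) (ha : a < (n : ℝ) - 1)
    (hC₁ : 0 < C₁) (hκ : 0 < κ) (hp0 : 0 < p) (hpn : p < n) :
    ∃ C : ℝ, 0 < C ∧ ∀ f : Vec n → Vec n,
      IsQR n K f → (∀ x ∈ unitBall n, f x ≠ 0) →
      InMiniowitz n C₀ α f → MultCond n a C₁ f →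
      ∀ g : Vec n → Vec n, (∀ᵐ ω ∂(sphMeasure n), HasNTLimit n κ f ω (g ω)) →
        ∀ L : Submodule ℝ (Vec n), Module.finrank ℝ L = n - 1 →
          ∫⁻ x in (L : Set (Vec n)) ∩ unitBall n,
              ENNReal.ofReal (‖f x‖ ^ p) ∂(μH[(n : ℝ) - 1]) ≤
            ENNReal.ofReal C * ∫⁻ ω, ENNReal.ofReal (‖g ω‖ ^ p) ∂(sphMeasure n) := by
  obtain ⟨b, hb, hble⟩ := exists_le_coneMeasure_transversalCap n hn
  obtain ⟨A, hA, hAle⟩ :=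
    exists_ofReal_norm_rpow_mul_le_setLIntegral n hn hK hC₀ hα ha hC₁ hκ hp0 hb
  obtain ⟨D, hD, hDle⟩ := exists_setLIntegral_transversalCap_le n hn
  obtain ⟨T, hT, hTle⟩ := exists_map_coneMeasure_le n hn
  obtain ⟨H, -, hHle⟩ := exists_hausdorffMeasure_hyperplane_le n hn
  refine ⟨A * D * T, by positivity, fun f hQR h0 hMin hMult g hg L hL => ?_⟩
  have hemb : MeasurableEmbedding (Subtype.val : sphere (0 : Vec n) 1 → Vec n) :=
    MeasurableEmbedding.subtype_coe isClosed_sphere.measurableSet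
  have hg' : ∀ᵐ ω : sphere (0 : Vec n) 1 ∂coneMeasure n, HasNTLimit n κ f ω (g ω) := by
    refine (hemb.ae_map_iff (p := fun ω => HasNTLimit n κ f ω (g ω))).1 (ae_mono hTle ?_)
    exact Measure.ae_smul_measure hg _
  have hgm : AEMeasurable (fun ω : sphere (0 : Vec n) 1 => ENNReal.ofReal (‖g ω‖ ^ p))
      (coneMeasure n) :=
    ((aemeasurable_of_hasNTLimit hκ hQR.1 hg').norm.pow_const p).ennreal_ofReal
  obtain ⟨e, he, hLe⟩ := exists_norm_eq_one_mem_orthogonal hn hL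
  have hLm : MeasurableSet (L : Set (Vec n)) := L.closed_of_finiteDimensional.measurableSet
  have hLBm := hLm.inter (measurableSet_unitBall n)
  set μ : Measure (Vec n) := (μH[(n : ℝ) - 1]).restrict ((L : Set (Vec n)) ∩ unitBall n) with hμ
  have : IsFiniteMeasure μ := ⟨by
    rw [hμ, Measure.restrict_apply_univ]
    exact (hHle L hL 0 1 one_pos).trans_lt ENNReal.ofReal_lt_top⟩
  set k : Vec n → sphere (0 : Vec n) 1 → ℝ≥0∞ := fun x =>
    (transversalCap n e x).indicator fun _ => ENNReal.ofReal (((1 - ‖x‖) ^ (n - 1))⁻¹) with hk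
  have hkm : Measurable (Function.uncurry k) :=
    Measurable.indicator (f := fun z : Vec n × sphere (0 : Vec n) 1 =>
        ENNReal.ofReal (((1 - ‖z.1‖) ^ (n - 1))⁻¹)) (by fun_prop)
      (measurableSet_setOf_mem_transversalCap n e)
  have hcapm : ∀ x, MeasurableSet (transversalCap n e x) := fun x =>
    measurable_prodMk_left (measurableSet_setOf_mem_transversalCap n e)
  calc ∫⁻ x, ENNReal.ofReal (‖f x‖ ^ p) ∂μ
      ≤ ∫⁻ x, ENNReal.ofReal A * ∫⁻ ω, k x ω * ENNReal.ofReal (‖g ω‖ ^ p) ∂coneMeasure n ∂μ := by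
        refine setLIntegral_mono' hLBm fun x hx => ?_
        have hx1 : ‖x‖ < 1 := by simpa [unitBall] using hx.2
        have hh0 : 0 < 1 - ‖x‖ := by linarith
        have h1 := hAle f hQR h0 hMin hMult g hg' x hx.2 _ (hcapm x) (fun ω hω => hω.1.le)
          (hble e x he (hLe x hx.1) hx.2)
        have h2 : ∫⁻ ω, k x ω * ENNReal.ofReal (‖g ω‖ ^ p) ∂coneMeasure n =
            ENNReal.ofReal (((1 - ‖x‖) ^ (n - 1))⁻¹) *
              ∫⁻ ω in transversalCap n e x, ENNReal.ofReal (‖g ω‖ ^ p) ∂coneMeasure n := by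
          rw [← lintegral_const_mul' _ _ ENNReal.ofReal_ne_top, ← lintegral_indicator (hcapm x)]
          refine lintegral_congr fun ω => ?_
          by_cases hω : ω ∈ transversalCap n e x <;> simp [hk, hω]
        rw [h2, mul_left_comm]
        refine le_trans (le_of_eq ?_) (mul_le_mul_right h1 _)
        rw [← ENNReal.ofReal_mul (by positivity)]
        congr 1
        field_simp
    _ = ENNReal.ofReal A * ∫⁻ ω, ENNReal.ofReal (‖g ω‖ ^ p) * ∫⁻ x, k x ω ∂μ ∂coneMeasure n := by
        rw [lintegral_const_mul' _ _ ENNReal.ofReal_ne_top,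
          lintegral_lintegral_swap (hkm.aemeasurable.mul hgm.comp_snd)]
        congr 1
        refine lintegral_congr fun ω => ?_
        rw [lintegral_mul_const' _ _ ENNReal.ofReal_ne_top, mul_comm]
    _ ≤ ENNReal.ofReal A * ∫⁻ ω : sphere (0 : Vec n) 1,
          ENNReal.ofReal (‖g ω‖ ^ p) * ENNReal.ofReal D ∂coneMeasure n := by
        gcongr with ω
        exact hDle L hL e he hLe ω
    _ = ENNReal.ofReal (A * D) *
          ∫⁻ ω, ENNReal.ofReal (‖g ω‖ ^ p) ∂((coneMeasure n).map Subtype.val) := by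
        rw [lintegral_mul_const' _ _ ENNReal.ofReal_ne_top, hemb.lintegral_map,
          ENNReal.ofReal_mul hA.le, mul_assoc, mul_comm (ENNReal.ofReal D)]
    _ ≤ ENNReal.ofReal (A * D) *
          ∫⁻ ω, ENNReal.ofReal (‖g ω‖ ^ p) ∂(ENNReal.ofReal T • sphMeasure n) := by
        gcongr
    _ = _ := by
        rw [lintegral_smul_measure, smul_eq_mul, ← mul_assoc,
          ENNReal.ofReal_mul (by positivity : 0 ≤ A * D)]

end
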